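/- arXiv:1909.06082 — 6 statements merged into one kernel-verified Lean document; each statement's English description precedes it below -/
import Mathlib

section
/- Let Φ be a Young's function, let Ω₁, Ω₂ ⊂ ℝⁿ be compact sets and Ω := Ω₁ × Ω₂. If π ∈ L^Φ(Ω), then its marginals satisfy P₁π ∈ L^Φ(Ω₁) and P₂π ∈ L^Φ(Ω₂), with the Luxemburg-norm bounds ‖P₁π‖_Φ ≤ max(1, |Ω₂|)·‖π‖_Φ and ‖P₂π‖_Φ ≤ max(1, |Ω₁|)·‖π‖_Φ, where |Ωᵢ| denotes the Lebesgue measure of Ωᵢ. -/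
open MeasureTheory Set ENNReal

/-- A Young's function: `Φ t = ∫₀ᵗ φ(s) ds` for an increasing, lower semicontinuous
`φ : [0,∞) → [0,∞]` with `φ 0 = 0` that is neither identically zero nor identically
infinite on `(0,∞)`. -/
def IsYoungFunction (Φ : ℝ → ℝ≥0∞) : Prop :=
  ∃ φ : ℝ → ℝ≥0∞,
    MonotoneOn φ (Ici 0) ∧
    LowerSemicontinuousOn φ (Ici 0) ∧
    φ 0 = 0 ∧
    (∃ t > (0 : ℝ), φ t ≠ 0) ∧
    (∃ t > (0 : ℝ), φ t ≠ ⊤) ∧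
    ∀ t ≥ (0 : ℝ), Φ t = ∫⁻ s in Ioc (0 : ℝ) t, φ s

/-- Membership in the Orlicz space `L^Φ(Ω)`: `f` is measurable with finite Luxemburg norm. -/
def MemOrlicz {α : Type*} [MeasureSpace α] (Φ : ℝ → ℝ≥0∞) (Ω : Set α) (f : α → ℝ) : Prop :=
  Measurable f ∧ ∃ lam > (0 : ℝ), ∫⁻ x in Ω, Φ (|f x| / lam) ≤ 1

/-- The Luxemburg norm of `f` on `Ω`. -/
noncomputable def luxNorm {α : Type*} [MeasureSpace α] (Φ : ℝ → ℝ≥0∞) (Ω : Set α)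
    (f : α → ℝ) : ℝ :=
  sInf {lam : ℝ | 0 < lam ∧ ∫⁻ x in Ω, Φ (|f x| / lam) ≤ 1}

/-- The primitive of a monotone function lies above its tangent lines. -/
lemma lintegral_Ioc_add_mul_le {ψ : ℝ → ℝ≥0∞} (hψ : MonotoneOn ψ (Ici 0)) {m t : ℝ}
    (hm : 0 ≤ m) (ht : 0 ≤ t) :
    (∫⁻ s in Ioc 0 m, ψ s) + ψ m * ENNReal.ofReal t ≤
      (∫⁻ s in Ioc 0 t, ψ s) + ψ m * ENNReal.ofReal m := by
  have split : ∀ {a b : ℝ}, 0 ≤ a → a ≤ b →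
      ∫⁻ s in Ioc 0 b, ψ s = (∫⁻ s in Ioc 0 a, ψ s) + ∫⁻ s in Ioc a b, ψ s := by
    intro a b ha hab
    rw [← Ioc_union_Ioc_eq_Ioc ha hab,
      lintegral_union measurableSet_Ioc (Ioc_disjoint_Ioc_of_le le_rfl)]
  have ofReal_split : ∀ {a b : ℝ}, 0 ≤ a → a ≤ b →
      ENNReal.ofReal b = ENNReal.ofReal a + ENNReal.ofReal (b - a) := by
    intro a b ha hab
    rw [← ENNReal.ofReal_add ha (sub_nonneg.2 hab), add_sub_cancel]
  rcases le_total m t with h | h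
  · rw [split hm h, ofReal_split hm h, mul_add, add_assoc, add_comm (ψ m * ENNReal.ofReal m)]
    gcongr
    calc ψ m * ENNReal.ofReal (t - m) = ∫⁻ _ in Ioc m t, ψ m := by simp
      _ ≤ ∫⁻ s in Ioc m t, ψ s :=
        setLIntegral_mono' measurableSet_Ioc fun s hs =>
          hψ hm (hm.trans hs.1.le) hs.1.le
  · rw [split ht h, ofReal_split ht h, mul_add, add_assoc, add_comm (ψ m * ENNReal.ofReal t)]
    gcongr
    calc ∫⁻ s in Ioc t m, ψ s ≤ ∫⁻ _ in Ioc t m, ψ m :=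
          setLIntegral_mono' measurableSet_Ioc fun s hs =>
            hψ (ht.trans hs.1.le) hm hs.2
      _ = ψ m * ENNReal.ofReal (m - t) := by simp

/-- Jensen's inequality for the primitive of a finite monotone function and a measure of mass at
most one. -/
lemma lintegral_Ioc_integral_le {α : Type*} [MeasurableSpace α] {μ : Measure α}
    (hμ : μ univ ≤ 1) {ψ : ℝ → ℝ≥0∞} (hψ : MonotoneOn ψ (Ici 0)) (hfin : ∀ t, ψ t ≠ ⊤)
    {g : α → ℝ} (hg : Integrable g μ) (hg0 : ∀ x, 0 ≤ g x) :
    ∫⁻ s in Ioc 0 (∫ x, g x ∂μ), ψ s ≤ ∫⁻ x, (∫⁻ s in Ioc 0 (g x), ψ s) ∂μ := by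
  set m := ∫ x, g x ∂μ with hm_def
  have hm : 0 ≤ m := integral_nonneg hg0
  set F : ℝ → ℝ≥0∞ := fun t => ∫⁻ s in Ioc 0 t, ψ s with hF
  have hcm : ψ m * ENNReal.ofReal m ≠ ⊤ := ENNReal.mul_ne_top (hfin m) ENNReal.ofReal_ne_top
  have hFm : F m ≤ ψ m * ENNReal.ofReal m := by
    simpa [hF] using lintegral_Ioc_add_mul_le hψ hm le_rfl
  have hFm_top : F m ≠ ⊤ := ne_top_of_le_ne_top hcm hFm
  obtain ⟨K, hK⟩ := exists_add_of_le hFm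
  have hK_top : K ≠ ⊤ := fun h => hcm (by rw [hK, h, add_top])
  have tangent : ∀ t, 0 ≤ t → ψ m * ENNReal.ofReal t ≤ F t + K := by
    intro t ht
    have h := lintegral_Ioc_add_mul_le hψ hm ht
    rw [hK] at h
    refine (ENNReal.add_le_add_iff_left hFm_top).1 (h.trans (le_of_eq ?_))
    simp only [hF]
    ring
  have h : F m + K ≤ (∫⁻ x, F (g x) ∂μ) + K :=
    calc F m + K = ψ m * ∫⁻ x, ENNReal.ofReal (g x) ∂μ := by
          rw [← hK, hm_def, ofReal_integral_eq_lintegral_ofReal hg (ae_of_all _ hg0)]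
      _ = ∫⁻ x, ψ m * ENNReal.ofReal (g x) ∂μ :=
          (lintegral_const_mul' _ _ (hfin m)).symm
      _ ≤ ∫⁻ x, (F (g x) + K) ∂μ := lintegral_mono fun x => tangent _ (hg0 x)
      _ = (∫⁻ x, F (g x) ∂μ) + K * μ univ := by
          rw [lintegral_add_right _ measurable_const, lintegral_const]
      _ ≤ (∫⁻ x, F (g x) ∂μ) + K := by
          gcongr
          exact mul_le_of_le_one_right' hμ
  exact (ENNReal.add_le_add_iff_right hK_top).1 h

namespace IsYoungFunction

variable {Φ : ℝ → ℝ≥0∞}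

lemma map_zero (hΦ : IsYoungFunction Φ) : Φ 0 = 0 := by
  obtain ⟨φ, -, -, -, -, -, h⟩ := hΦ
  simp [h 0 le_rfl]

lemma monotoneOn (hΦ : IsYoungFunction Φ) : MonotoneOn Φ (Ici 0) := by
  obtain ⟨φ, -, -, -, -, -, h⟩ := hΦ
  intro a ha b hb hab
  rw [h a ha, h b hb]
  exact lintegral_mono_set (Ioc_subset_Ioc_right hab)

lemma measurable_comp (hΦ : IsYoungFunction Φ) {α : Type*} [MeasurableSpace α] {g : α → ℝ}
    (hg : Measurable g) (hg0 : ∀ x, 0 ≤ g x) : Measurable fun x => Φ (g x) := by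
  have hmono : Monotone fun t : ℝ => Φ (max t 0) := fun a b hab =>
    hΦ.monotoneOn (le_max_right a 0) (le_max_right b 0) (max_le_max_right 0 hab)
  have h := hmono.measurable.comp hg
  simpa [Function.comp_def, max_eq_left, hg0] using h

/-- Jensen's inequality for a Young's function and a measure of mass at most one. -/
lemma map_integral_le (hΦ : IsYoungFunction Φ) {α : Type*} [MeasurableSpace α] {μ : Measure α}
    (hμ : μ univ ≤ 1) {g : α → ℝ} (hg : Integrable g μ) (hg0 : ∀ x, 0 ≤ g x) :
    Φ (∫ x, g x ∂μ) ≤ ∫⁻ x, Φ (g x) ∂μ := by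
  obtain ⟨φ, hφ, -, -, -, -, h⟩ := hΦ
  have hm : 0 ≤ ∫ x, g x ∂μ := integral_nonneg hg0
  have hψ (k : ℕ) : MonotoneOn (fun s => min (φ s) k) (Ici 0) :=
    fun a ha b hb hab => min_le_min_right _ (hφ ha hb hab)
  have hsup : ∫⁻ s in Ioc 0 (∫ x, g x ∂μ), φ s =
      ⨆ k : ℕ, ∫⁻ s in Ioc 0 (∫ x, g x ∂μ), min (φ s) k := by
    rw [← lintegral_iSup']
    · refine lintegral_congr fun s => ?_
      rw [← inf_iSup_eq, ENNReal.iSup_natCast, inf_top_eq]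
    · exact fun k => aemeasurable_restrict_of_monotoneOn measurableSet_Ioc
        ((hψ k).mono fun s hs => hs.1.le)
    · exact ae_of_all _ fun s a b hab => min_le_min_left _ (by exact_mod_cast hab)
  rw [h _ hm, hsup]
  refine iSup_le fun k => ?_
  refine (lintegral_Ioc_integral_le hμ (hψ k) (fun t => ?_) hg hg0).trans ?_
  · exact ne_top_of_le_ne_top (ENNReal.natCast_ne_top k) (min_le_right _ _)
  · refine lintegral_mono fun x => ?_
    rw [h _ (hg0 x)]
    exact lintegral_mono fun s => min_le_left _ _

/-- Jensen's inequality in scaled form, for a measure of mass at most `M` with `1 ≤ M`. -/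
lemma map_abs_integral_div_le (hΦ : IsYoungFunction Φ) {α : Type*} [MeasurableSpace α]
    {ν : Measure α} {M : ℝ} (hM : 1 ≤ M) (hν : ν univ ≤ ENNReal.ofReal M) {lam : ℝ}
    (hlam : 0 < lam) (g : α → ℝ) :
    Φ (|∫ x, g x ∂ν| / (M * lam)) ≤ ∫⁻ x, Φ (|g x| / lam) ∂ν := by
  have hM0 : 0 < M := one_pos.trans_le hM
  by_cases hg : Integrable g ν
  swap
  · simp [integral_undef hg, hΦ.map_zero]
  set c : ℝ≥0∞ := (ENNReal.ofReal M)⁻¹ with hc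
  have hM1 : 1 ≤ ENNReal.ofReal M := by simpa using ENNReal.ofReal_le_ofReal hM
  have hc1 : c ≤ 1 := ENNReal.inv_le_one.2 hM1
  have hμ : (c • ν) univ ≤ 1 := by
    rw [Measure.smul_apply, smul_eq_mul]
    exact (mul_le_mul_right hν c).trans (ENNReal.inv_mul_le_one _)
  have hint : Integrable (fun x => |g x| / lam) (c • ν) :=
    (hg.abs.div_const lam).smul_measure (ne_top_of_le_ne_top one_ne_top hc1)
  have heq : ∫ x, |g x| / lam ∂(c • ν) = (∫ x, |g x| ∂ν) / (M * lam) := by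
    rw [integral_smul_measure, integral_div, hc, ENNReal.toReal_inv,
      ENNReal.toReal_ofReal hM0.le, smul_eq_mul]
    field_simp
  calc Φ (|∫ x, g x ∂ν| / (M * lam)) ≤ Φ ((∫ x, |g x| ∂ν) / (M * lam)) := by
        refine hΦ.monotoneOn (mem_Ici.2 (by positivity))
          (mem_Ici.2 (div_nonneg (integral_nonneg fun x => abs_nonneg _) (by positivity))) ?_
        gcongr
        exact abs_integral_le_integral_abs
    _ ≤ ∫⁻ x, Φ (|g x| / lam) ∂(c • ν) := by
        rw [← heq]
        exact hΦ.map_integral_le hμ hint fun x => by positivity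
    _ ≤ ∫⁻ x, Φ (|g x| / lam) ∂ν := by
        rw [lintegral_smul_measure, smul_eq_mul]
        exact mul_le_of_le_one_left' hc1

end IsYoungFunction

/-- If every admissible level for `g`, scaled by `M`, is admissible for `f`, then `f` lies in the
Orlicz space and its norm is at most `M` times that of `g`. -/
lemma MemOrlicz.of_scaling {α β : Type*} [MeasureSpace α] [MeasureSpace β] {Φ : ℝ → ℝ≥0∞}
    {A : Set α} {B : Set β} {f : α → ℝ} {g : β → ℝ} {M : ℝ} (hg : MemOrlicz Φ B g)
    (hf : Measurable f) (hM : 0 < M)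
    (h : ∀ lam > 0, ∫⁻ x in B, Φ (|g x| / lam) ≤ 1 → ∫⁻ x in A, Φ (|f x| / (M * lam)) ≤ 1) :
    MemOrlicz Φ A f ∧ luxNorm Φ A f ≤ M * luxNorm Φ B g := by
  obtain ⟨-, l, hl, hle⟩ := hg
  refine ⟨⟨hf, M * l, mul_pos hM hl, h l hl hle⟩, ?_⟩
  rw [← div_le_iff₀' hM]
  refine le_csInf ⟨l, hl, hle⟩ fun lam hlam => ?_
  rw [div_le_iff₀' hM]
  exact csInf_le ⟨0, fun x hx => hx.1.le⟩ ⟨mul_pos hM hlam.1, h lam hlam.1 hlam.2⟩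

/-- If `π ∈ L^Φ(Ω₁ × Ω₂)` then the marginals satisfy `Pᵢπ ∈ L^Φ(Ωᵢ)` with
`‖Pᵢπ‖_Φ ≤ max(1,|Ω_{3-i}|) ‖π‖_Φ`. -/
theorem marginals_mem_orlicz {n : ℕ} (Φ : ℝ → ℝ≥0∞) (hΦ : IsYoungFunction Φ)
    (Ω₁ Ω₂ : Set (Fin n → ℝ)) (hΩ₁ : IsCompact Ω₁) (hΩ₂ : IsCompact Ω₂)
    (π : (Fin n → ℝ) × (Fin n → ℝ) → ℝ)
    (hπ : MemOrlicz Φ (Ω₁ ×ˢ Ω₂) π) :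
    (MemOrlicz Φ Ω₁ (fun x₁ => ∫ x₂ in Ω₂, π (x₁, x₂)) ∧
      luxNorm Φ Ω₁ (fun x₁ => ∫ x₂ in Ω₂, π (x₁, x₂)) ≤
        max 1 (volume Ω₂).toReal * luxNorm Φ (Ω₁ ×ˢ Ω₂) π) ∧
    (MemOrlicz Φ Ω₂ (fun x₂ => ∫ x₁ in Ω₁, π (x₁, x₂)) ∧
      luxNorm Φ Ω₂ (fun x₂ => ∫ x₁ in Ω₁, π (x₁, x₂)) ≤
        max 1 (volume Ω₁).toReal * luxNorm Φ (Ω₁ ×ˢ Ω₂) π) := by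
  have hmeas : Measurable π := hπ.1
  have hprod (lam : ℝ) : ∫⁻ z in Ω₁ ×ˢ Ω₂, Φ (|π z| / lam) =
      ∫⁻ z, Φ (|π z| / lam) ∂((volume.restrict Ω₁).prod (volume.restrict Ω₂)) := by
    rw [Measure.prod_restrict, Measure.volume_eq_prod]
  have hΦπ {lam : ℝ} (hlam : 0 < lam) : Measurable fun z => Φ (|π z| / lam) :=
    hΦ.measurable_comp ((measurable_abs.comp hmeas).div_const lam) fun z =>
      div_nonneg (abs_nonneg _) hlam.le
  have hmass {Ω : Set (Fin n → ℝ)} (hΩ : IsCompact Ω) :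
      volume.restrict Ω univ ≤ ENNReal.ofReal (max 1 (volume Ω).toReal) := by
    rw [Measure.restrict_apply_univ]
    exact ENNReal.le_ofReal_iff_toReal_le hΩ.measure_ne_top (by positivity) |>.2 (le_max_right _ _)
  constructor
  · refine hπ.of_scaling hmeas.stronglyMeasurable.integral_prod_right'.measurable
      (by positivity) fun lam hlam hle => le_trans ?_ hle
    rw [hprod, lintegral_prod _ (hΦπ hlam).aemeasurable]
    exact lintegral_mono fun x =>
      hΦ.map_abs_integral_div_le (le_max_left _ _) (hmass hΩ₂) hlam _
  · refine hπ.of_scaling hmeas.stronglyMeasurable.integral_prod_left'.measurable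
      (by positivity) fun lam hlam hle => le_trans ?_ hle
    rw [hprod, lintegral_prod_symm _ (hΦπ hlam).aemeasurable]
    exact lintegral_mono fun x =>
      hΦ.map_abs_integral_div_le (le_max_left _ _) (hmass hΩ₁) hlam _
end

section
/- Let Ω₁, Ω₂ ⊂ ℝⁿ be bounded measurable sets and let Φ be a Young's function satisfying Φ(xy) ≤ C·Φ(x)·Φ(y) for all x, y ≥ 0 and some constant C > 0. If μ₁ ∈ L^Φ(Ω₁) and μ₂ ∈ L^Φ(Ω₂), then the product function π(x₁,x₂) := μ₁(x₁)·μ₂(x₂) belongs to L^Φ(Ω₁ × Ω₂). -/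
open MeasureTheory Set ENNReal NNReal

/-- A Young's function is nondecreasing on `[0, ∞)`. -/
theorem IsYoungFunction.monotoneOn_s1 {Φ : ℝ → ℝ≥0∞} (hΦ : IsYoungFunction Φ) :
    MonotoneOn Φ (Ici 0) := by
  obtain ⟨φ, -, -, -, -, -, hint⟩ := hΦ
  intro x hx y hy hxy
  rw [hint x hx, hint y hy]
  exact lintegral_mono_set (Ioc_subset_Ioc_right hxy)

/-- Composing a Young's function with a nonnegative measurable function gives a measurable
function. -/
theorem IsYoungFunction.measurable_comp_s1 {α : Type*} [MeasurableSpace α] {Φ : ℝ → ℝ≥0∞}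
    (hΦ : IsYoungFunction Φ) {g : α → ℝ} (hg : Measurable g) (hg0 : ∀ x, 0 ≤ g x) :
    Measurable fun x => Φ (g x) := by
  have hmono : Monotone fun t : ℝ => Φ (max t 0) := fun x y hxy =>
    hΦ.monotoneOn_s1 (le_max_right x 0) (le_max_right y 0) (max_le_max_right 0 hxy)
  have heq : (fun x => Φ (g x)) = (fun t : ℝ => Φ (max t 0)) ∘ g := by
    funext x
    simp [max_eq_left (hg0 x)]
  rw [heq]
  exact hmono.measurable.comp hg

/-- A Young's function tends to `0` at `0`, in the form of smallness against a constant. -/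
theorem IsYoungFunction.exists_mul_le_one {Φ : ℝ → ℝ≥0∞} (hΦ : IsYoungFunction Φ) (A : ℝ≥0) :
    ∃ ε > (0 : ℝ), A * Φ ε ≤ 1 := by
  obtain ⟨φ, hmono, -, -, -, ⟨t, ht, htop⟩, hint⟩ := hΦ
  lift φ t to ℝ≥0 using htop with M hM
  have hpos : (0 : ℝ) < A * M + 1 := by positivity
  have hε : 0 < min t (A * M + 1 : ℝ)⁻¹ := lt_min ht (inv_pos.2 hpos)
  set ε := min t (A * M + 1 : ℝ)⁻¹ with hε_def
  refine ⟨ε, hε, ?_⟩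
  have hle : Φ ε ≤ M * ENNReal.ofReal ε := by
    rw [hint ε hε.le]
    calc ∫⁻ s in Ioc (0 : ℝ) ε, φ s ≤ ∫⁻ _ in Ioc (0 : ℝ) ε, (M : ℝ≥0∞) := by
          refine setLIntegral_mono measurable_const fun s hs => ?_
          rw [hM]
          exact hmono hs.1.le ht.le (hs.2.trans (min_le_left _ _))
      _ = M * ENNReal.ofReal ε := by simp
  have hreal : (A * M : ℝ) * ε ≤ 1 := by
    calc (A * M : ℝ) * ε ≤ (A * M + 1) * (A * M + 1 : ℝ)⁻¹ := by
          gcongr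
          · linarith
          · exact min_le_right _ _
      _ = 1 := mul_inv_cancel₀ hpos.ne'
  calc (A : ℝ≥0∞) * Φ ε ≤ A * (M * ENNReal.ofReal ε) := by gcongr
    _ = ENNReal.ofReal ((A * M : ℝ) * ε) := by
        rw [ENNReal.ofReal_mul (by positivity), ENNReal.ofReal_mul (by positivity),
          ENNReal.ofReal_coe_nnreal, ENNReal.ofReal_coe_nnreal, mul_assoc]
    _ ≤ 1 := ENNReal.ofReal_le_one.2 hreal

/-- If `Φ` is a Young's function with `Φ(xy) ≤ C Φ(x) Φ(y)` and `μᵢ ∈ L^Φ(Ωᵢ)`, then the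
product function `π(x₁,x₂) = μ₁(x₁) μ₂(x₂)` belongs to `L^Φ(Ω₁ × Ω₂)`. -/
theorem product_mem_orlicz {n : ℕ} (Φ : ℝ → ℝ≥0∞) (hΦ : IsYoungFunction Φ)
    (Ω₁ Ω₂ : Set (Fin n → ℝ))
    (hΩ₁m : MeasurableSet Ω₁) (hΩ₂m : MeasurableSet Ω₂)
    (hΩ₁b : Bornology.IsBounded Ω₁) (hΩ₂b : Bornology.IsBounded Ω₂)
    (C : ℝ≥0) (hC : 0 < C)
    (hmul : ∀ x ≥ (0 : ℝ), ∀ y ≥ (0 : ℝ), Φ (x * y) ≤ C * Φ x * Φ y)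
    (μ₁ μ₂ : (Fin n → ℝ) → ℝ)
    (hμ₁ : MemOrlicz Φ Ω₁ μ₁) (hμ₂ : MemOrlicz Φ Ω₂ μ₂) :
    MemOrlicz Φ (Ω₁ ×ˢ Ω₂) (fun x => μ₁ x.1 * μ₂ x.2) := by
  obtain ⟨hm₁, l₁, hl₁, hi₁⟩ := hμ₁
  obtain ⟨hm₂, l₂, hl₂, hi₂⟩ := hμ₂
  obtain ⟨ε, hε, hεC⟩ := hΦ.exists_mul_le_one (C * C)
  refine ⟨by fun_prop, l₁ * l₂ / ε, by positivity, ?_⟩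
  have hmeas₁ : Measurable fun x => Φ (|μ₁ x| / l₁) :=
    hΦ.measurable_comp_s1 (by fun_prop) fun x => by positivity
  have hmeas₂ : Measurable fun x => Φ (|μ₂ x| / l₂) :=
    hΦ.measurable_comp_s1 (by fun_prop) fun x => by positivity
  have hpt : ∀ x : (Fin n → ℝ) × (Fin n → ℝ), Φ (|μ₁ x.1 * μ₂ x.2| / (l₁ * l₂ / ε)) ≤
      ((C * C : ℝ≥0) * Φ ε) * (Φ (|μ₁ x.1| / l₁) * Φ (|μ₂ x.2| / l₂)) := by
    intro x
    have heq : |μ₁ x.1 * μ₂ x.2| / (l₁ * l₂ / ε) =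
        ε * ((|μ₁ x.1| / l₁) * (|μ₂ x.2| / l₂)) := by
      rw [abs_mul]
      field_simp
    rw [heq]
    calc Φ (ε * ((|μ₁ x.1| / l₁) * (|μ₂ x.2| / l₂)))
        ≤ C * Φ ε * Φ ((|μ₁ x.1| / l₁) * (|μ₂ x.2| / l₂)) :=
          hmul _ hε.le _ (by positivity)
      _ ≤ C * Φ ε * (C * Φ (|μ₁ x.1| / l₁) * Φ (|μ₂ x.2| / l₂)) := by
          gcongr
          exact hmul _ (by positivity) _ (by positivity)
      _ = _ := by
          push_cast
          ring
  calc ∫⁻ x in Ω₁ ×ˢ Ω₂, Φ (|μ₁ x.1 * μ₂ x.2| / (l₁ * l₂ / ε))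
      ≤ ∫⁻ x in Ω₁ ×ˢ Ω₂, Φ (|μ₁ x.1| / l₁) * Φ (|μ₂ x.2| / l₂) := by
        refine lintegral_mono fun x => (hpt x).trans ?_
        exact mul_le_of_le_one_left zero_le hεC
    _ = (∫⁻ x in Ω₁, Φ (|μ₁ x| / l₁)) * ∫⁻ y in Ω₂, Φ (|μ₂ y| / l₂) := by
        rw [Measure.volume_eq_prod, ← Measure.prod_restrict]
        exact lintegral_prod_mul hmeas₁.aemeasurable hmeas₂.aemeasurable
    _ ≤ 1 := mul_le_one' hi₁ hi₂
end

section
/- Strong duality for quadratically regularized optimal transport: let Ω₁, Ω₂ ⊂ ℝⁿ be compact, Ω := Ω₁ × Ω₂, let μ₁, μ₂ be finite nonnegative Borel measures on Ω₁, Ω₂ with μ₁(Ω₁) = μ₂(Ω₂), let c : Ω → ℝ be continuous and γ > 0. Then the infimum of ∫_Ω c·π dx + (γ/2)·∫_Ω π² dx over all measurable π : Ω → [0,∞) such that the measure π dx has marginals μ₁ and μ₂ equals the supremum of ∫_{Ω₁} α₁ dμ₁ + ∫_{Ω₂} α₂ dμ₂ − (1/(2γ))·∫_Ω ((α₁(x₁)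 + α₂(x₂) − c(x₁,x₂))₊)² dx over all continuous α₁ : Ω₁ → ℝ and α₂ : Ω₂ → ℝ. Moreover, if the supremum is finite, the infimum is attained. -/
open MeasureTheory Set ENNReal NNReal

/-- A transport plan density `π` on `Ω₁ × Ω₂` is feasible for the marginals `μ₁, μ₂` if it is
measurable, nonnegative, and the measure `π dx` has marginals `μ₁` and `μ₂`. -/
def IsFeasiblePlan {n : ℕ} (Ω₁ Ω₂ : Set (Fin n → ℝ)) (μ₁ μ₂ : Measure (Fin n → ℝ))
    (π : (Fin n → ℝ) × (Fin n → ℝ) → ℝ) : Prop :=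
  Measurable π ∧ (∀ x, 0 ≤ π x) ∧
    Measure.map Prod.fst
      ((volume.restrict (Ω₁ ×ˢ Ω₂)).withDensity fun x => ENNReal.ofReal (π x)) = μ₁ ∧
    Measure.map Prod.snd
      ((volume.restrict (Ω₁ ×ˢ Ω₂)).withDensity fun x => ENNReal.ofReal (π x)) = μ₂

/-- The quadratically regularized primal objective `∫_Ω c π dx + (γ/2) ∫_Ω π² dx`,
as an extended real number (`+∞` if `π ∉ L²`). -/
noncomputable def primalValueQuad {n : ℕ} (Ω₁ Ω₂ : Set (Fin n → ℝ))
    (c : (Fin n → ℝ) × (Fin n → ℝ) → ℝ) (γ : ℝ)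
    (π : (Fin n → ℝ) × (Fin n → ℝ) → ℝ) : EReal :=
  ((∫ x in Ω₁ ×ˢ Ω₂, c x * π x : ℝ) : EReal) +
    (γ / 2 : ℝ) * (∫⁻ x in Ω₁ ×ˢ Ω₂, ENNReal.ofReal (π x) ^ 2).toEReal

/-- The quadratic dual objective
`∫_{Ω₁} α₁ dμ₁ + ∫_{Ω₂} α₂ dμ₂ − (1/(2γ)) ∫_Ω ((α₁ ⊕ α₂ − c)₊)² dx`. -/
noncomputable def dualValueQuad {n : ℕ} (Ω₁ Ω₂ : Set (Fin n → ℝ))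
    (μ₁ μ₂ : Measure (Fin n → ℝ)) (c : (Fin n → ℝ) × (Fin n → ℝ) → ℝ) (γ : ℝ)
    (α₁ α₂ : (Fin n → ℝ) → ℝ) : ℝ :=
  ∫ x in Ω₁, α₁ x ∂μ₁ + ∫ x in Ω₂, α₂ x ∂μ₂ -
    (1 / (2 * γ)) * ∫ x in Ω₁ ×ˢ Ω₂, max (α₁ x.1 + α₂ x.2 - c x) 0 ^ 2

/-- A linear functional, given by its graph on a subspace and dominated there by a continuous
convex function, extends to a continuous linear functional dominated everywhere. -/
theorem exists_clm_extension_of_le_convex {E : Type*} [NormedAddCommGroup E] [NormedSpace ℝ E]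
    {Φ : E → ℝ} (hconv : ConvexOn ℝ univ Φ) (hcont : Continuous Φ) (B : Submodule ℝ (E × ℝ))
    (hB : ∀ q ∈ B, q.2 ≤ Φ q.1) :
    ∃ Λ : E →L[ℝ] ℝ, (∀ q ∈ B, Λ q.1 = q.2) ∧ ∀ f, Λ f ≤ Φ f := by
  have hAconv : Convex ℝ {q : E × ℝ | Φ q.1 < q.2} := by
    simpa using hconv.convex_strict_epigraph
  have hAopen : IsOpen {q : E × ℝ | Φ q.1 < q.2} :=
    isOpen_lt (hcont.comp continuous_fst) continuous_snd
  obtain ⟨φ, u, hA, hBu⟩ := geometric_hahn_banach_open hAconv hAopen B.convex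
    (Set.disjoint_left.2 fun q hq hqB => absurd (hB q hqB) (not_le.2 hq))
  have hu : u ≤ 0 := by simpa using hBu 0 B.zero_mem
  have hBz : ∀ q ∈ B, φ q = 0 := by
    intro q hq
    by_contra hne
    have h := hBu (((u - 1) / φ q) • q) (B.smul_mem _ hq)
    rw [map_smul, smul_eq_mul, div_mul_cancel₀ _ hne] at h
    linarith
  have hsplit : ∀ f t, φ (f, t) = φ (f, 0) + t * φ (0, 1) := by
    intro f t
    have : ((f, t) : E × ℝ) = (f, 0) + t • (0, 1) := by simp
    rw [this, map_add, map_smul, smul_eq_mul]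
  set s := φ (0, 1) with hs
  have hs0 : s < 0 := by
    have h := hA (0, |Φ 0| + 1) (by
      show Φ 0 < |Φ 0| + 1
      linarith [le_abs_self (Φ 0)])
    rw [hsplit, ← Prod.zero_eq_mk, map_zero] at h
    nlinarith [abs_nonneg (Φ 0)]
  refine ⟨(-s⁻¹) • φ.comp (ContinuousLinearMap.inl ℝ E ℝ), ?_, ?_⟩
  · rintro ⟨f, t⟩ hq
    have h := hBz _ hq
    rw [hsplit] at h
    simp only [_root_.smul_apply, ContinuousLinearMap.comp_apply,
      ContinuousLinearMap.inl_apply, smul_eq_mul]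
    have : φ (f, 0) = -(t * s) := by linarith
    have hne : s ≠ 0 := hs0.ne
    rw [this]
    field_simp
  · intro f
    simp only [_root_.smul_apply, ContinuousLinearMap.comp_apply,
      ContinuousLinearMap.inl_apply, smul_eq_mul]
    refine le_of_forall_gt_imp_ge_of_dense fun t ht => ?_
    have h := hA (f, t) ht
    rw [hsplit] at h
    have : -s⁻¹ * φ (f, 0) = φ (f, 0) / (-s) := by rw [div_eq_mul_inv, inv_neg]; ring
    rw [this, div_le_iff₀ (by linarith)]
    linarith

/-- The norm of the positive part is sublinear on `L²`. -/
theorem Lp.norm_posPart_add_le {X : Type*} [MeasurableSpace X] {ν : Measure X}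
    (f g : Lp ℝ 2 ν) {a b : ℝ} (ha : 0 ≤ a) (hb : 0 ≤ b) :
    ‖Lp.posPart (a • f + b • g)‖ ≤ a * ‖Lp.posPart f‖ + b * ‖Lp.posPart g‖ := by
  calc ‖Lp.posPart (a • f + b • g)‖ ≤ ‖a • Lp.posPart f + b • Lp.posPart g‖ := by
        refine Lp.norm_le_norm_of_ae_le ?_
        filter_upwards [Lp.coeFn_posPart (a • f + b • g), Lp.coeFn_posPart f,
          Lp.coeFn_posPart g, Lp.coeFn_add (a • f) (b • g), Lp.coeFn_smul a f, Lp.coeFn_smul b g,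
          Lp.coeFn_add (a • Lp.posPart f) (b • Lp.posPart g), Lp.coeFn_smul a (Lp.posPart f),
          Lp.coeFn_smul b (Lp.posPart g)] with x h1 h2 h3 h4 h5 h6 h7 h8 h9
        simp only [h1, h2, h3, h4, h5, h6, h7, h8, h9, Pi.add_apply, Pi.smul_apply, smul_eq_mul,
          Real.norm_eq_abs]
        have hf := mul_le_mul_of_nonneg_left (le_max_left (f x) 0) ha
        have hg := mul_le_mul_of_nonneg_left (le_max_left (g x) 0) hb
        have hf0 := mul_nonneg ha (le_max_right (f x) 0)
        have hg0 := mul_nonneg hb (le_max_right (g x) 0)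
        rw [abs_of_nonneg (le_max_right _ _), abs_of_nonneg (by linarith)]
        exact max_le (by linarith) (by linarith)
    _ ≤ a * ‖Lp.posPart f‖ + b * ‖Lp.posPart g‖ := by
        refine (norm_add_le _ _).trans ?_
        rw [norm_smul, norm_smul, Real.norm_of_nonneg ha, Real.norm_of_nonneg hb]

theorem convexOn_sq_norm_posPart_sub {X : Type*} [MeasurableSpace X] {ν : Measure X}
    (c : Lp ℝ 2 ν) {k : ℝ} (hk : 0 ≤ k) (M : ℝ) :
    ConvexOn ℝ univ fun f : Lp ℝ 2 ν => M + k * ‖Lp.posPart (f - c)‖ ^ 2 := by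
  refine ⟨convex_univ, fun f _ g _ a b ha hb hab => ?_⟩
  have hsub : a • f + b • g - c = a • (f - c) + b • (g - c) := by
    have : c = a • c + b • c := by rw [← add_smul, hab, one_smul]
    nth_rewrite 1 [this]
    simp only [smul_sub]; abel
  have h := Lp.norm_posPart_add_le (f - c) (g - c) ha hb
  simp only [smul_eq_mul, hsub]
  set x := ‖Lp.posPart (f - c)‖
  set y := ‖Lp.posPart (g - c)‖
  have h2 : ‖Lp.posPart (a • (f - c) + b • (g - c))‖ ^ 2 ≤ (a * x + b * y) ^ 2 :=
    pow_le_pow_left₀ (norm_nonneg _) h 2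
  have h3 : (a * x + b * y) ^ 2 ≤ a * x ^ 2 + b * y ^ 2 := by
    obtain rfl : b = 1 - a := by linarith
    nlinarith [mul_nonneg (mul_nonneg ha hb) (sq_nonneg (x - y))]
  have h4 := mul_le_mul_of_nonneg_left (h2.trans h3) hk
  have h5 : a * M + b * M = M := by rw [← add_mul, hab, one_mul]
  nlinarith

theorem Lp.norm_posPart_mono {X : Type*} [MeasurableSpace X] {ν : Measure X}
    {f g : Lp ℝ 2 ν} (h : f ≤ᵐ[ν] g) : ‖Lp.posPart f‖ ≤ ‖Lp.posPart g‖ := by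
  refine Lp.norm_le_norm_of_ae_le ?_
  filter_upwards [Lp.coeFn_posPart f, Lp.coeFn_posPart g, h] with x h1 h2 h3
  rw [h1, h2, Real.norm_of_nonneg (le_max_right _ _), Real.norm_of_nonneg (le_max_right _ _)]
  exact max_le_max h3 le_rfl

/-- Abstract duality in `L²`: a linear functional on a subspace dominated by
`M + ‖(f - c)₊‖² / (2γ)` is represented by a nonnegative `p` with `⟪p, c⟫ + γ/2 ‖p‖² ≤ M`. -/
theorem exists_nonneg_representative {X : Type*} [MeasurableSpace X] {ν : Measure X}
    (c : Lp ℝ 2 ν) {γ : ℝ} (hγ : 0 < γ) (M : ℝ) (B : Submodule ℝ (Lp ℝ 2 ν × ℝ))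
    (hB : ∀ q ∈ B, q.2 ≤ M + 1 / (2 * γ) * ‖Lp.posPart (q.1 - c)‖ ^ 2) :
    ∃ p : Lp ℝ 2 ν, 0 ≤ᵐ[ν] p ∧ (∀ q ∈ B, inner ℝ p q.1 = q.2) ∧
      inner ℝ p c + γ / 2 * ‖p‖ ^ 2 ≤ M := by
  have hk : 0 ≤ 1 / (2 * γ) := by positivity
  obtain ⟨Λ, hΛB, hΛ⟩ := exists_clm_extension_of_le_convex
    (convexOn_sq_norm_posPart_sub c hk M)
    (continuous_const.add (continuous_const.mul
      ((Lp.continuous_posPart.comp (continuous_id.sub continuous_const)).norm.pow 2))) B hB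
  set p := (InnerProductSpace.toDual ℝ (Lp ℝ 2 ν)).symm Λ with hp
  have hpΛ : ∀ f, inner ℝ p f = Λ f := fun f => InnerProductSpace.toDual_symm_apply
  refine ⟨p, ?_, fun q hq => (hpΛ _).trans (hΛB q hq), ?_⟩
  · set m := Lp.negPart p with hm
    have hmae : m =ᵐ[ν] fun x => -min (p x) 0 := Lp.coeFn_negPart p
    have hinner : inner ℝ p m = -‖m‖ ^ 2 := by
      rw [← real_inner_self_eq_norm_sq, L2.inner_def, L2.inner_def, ← integral_neg]
      refine integral_congr_ae ?_
      filter_upwards [hmae] with x hx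
      simp only [hx, RCLike.inner_apply, conj_trivial]
      rcases le_total (p x) 0 with h | h <;> simp [h]
    have hbound : ∀ t : ℝ, 0 ≤ t →
        t * ‖m‖ ^ 2 ≤ M + 1 / (2 * γ) * ‖Lp.posPart (-c)‖ ^ 2 := by
      intro t ht
      have h1 := hΛ (-t • m)
      rw [← hpΛ, inner_smul_right, hinner] at h1
      have h2 : ‖Lp.posPart (-t • m - c)‖ ≤ ‖Lp.posPart (-c)‖ := by
        refine Lp.norm_posPart_mono ?_
        filter_upwards [hmae, Lp.coeFn_sub (-t • m) c, Lp.coeFn_neg c, Lp.coeFn_smul (-t) m]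
          with x h1 h2 h3 h4
        simp only [h2, h3, h4, Pi.sub_apply, Pi.neg_apply, Pi.smul_apply, smul_eq_mul]
        have : 0 ≤ m x := by rw [h1]; simp
        nlinarith
      have h3 := mul_le_mul_of_nonneg_left (pow_le_pow_left₀ (norm_nonneg _) h2 2) hk
      linarith
    have hm0 : ‖m‖ = 0 := by
      by_contra hne
      have hpos : 0 < ‖m‖ ^ 2 := by positivity
      set C := M + 1 / (2 * γ) * ‖Lp.posPart (-c)‖ ^ 2
      have := hbound ((|C| + 1) / ‖m‖ ^ 2) (by positivity)
      rw [div_mul_cancel₀ _ hpos.ne'] at this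
      linarith [le_abs_self C]
    have hmz : m =ᵐ[ν] 0 := by
      rw [norm_eq_zero.1 hm0]; exact Lp.coeFn_zero _ _ _
    filter_upwards [hmae, hmz] with x h1 h2
    rw [h1] at h2
    simpa using h2
  · have h := hΛ (c + γ • p)
    have hpp : ‖Lp.posPart (c + γ • p - c)‖ ≤ γ * ‖p‖ := by
      rw [add_sub_cancel_left]
      refine le_of_le_of_eq ?_ ((norm_smul γ p).trans (by rw [Real.norm_of_nonneg hγ.le]))
      refine Lp.norm_le_norm_of_ae_le ?_
      filter_upwards [Lp.coeFn_posPart (γ • p)] with x hx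
      rw [hx, Real.norm_of_nonneg (le_max_right _ _)]
      exact max_le (le_abs_self _) (abs_nonneg _)
    have h2 := mul_le_mul_of_nonneg_left (pow_le_pow_left₀ (norm_nonneg _) hpp 2) hk
    have h3 : 1 / (2 * γ) * (γ * ‖p‖) ^ 2 = γ / 2 * ‖p‖ ^ 2 := by field_simp
    rw [← hpΛ, inner_add_right, inner_smul_right, real_inner_self_eq_norm_sq] at h
    linarith

theorem Lp.norm_sq_eq_integral {X : Type*} [MeasurableSpace X] {ν : Measure X}
    (f : Lp ℝ 2 ν) : ‖f‖ ^ 2 = ∫ x, f x ^ 2 ∂ν := by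
  rw [← real_inner_self_eq_norm_sq, L2.inner_def]
  refine integral_congr_ae (ae_of_all _ fun x => ?_)
  simp only [RCLike.inner_apply, conj_trivial, sq]

theorem memLp_restrict_of_continuousOn {Y : Type*} [TopologicalSpace Y] [T2Space Y]
    [MeasurableSpace Y] [BorelSpace Y] {μ : Measure Y} [IsFiniteMeasureOnCompacts μ]
    {K : Set Y} (hK : IsCompact K) {f : Y → ℝ} (hf : ContinuousOn f K) (p : ℝ≥0∞) :
    MemLp f p (μ.restrict K) := by
  have : IsFiniteMeasure (μ.restrict K) := isFiniteMeasure_restrict.2 hK.measure_ne_top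
  obtain ⟨C, hC⟩ := hK.exists_bound_of_continuousOn hf
  exact MemLp.of_bound (hf.aestronglyMeasurable hK.measurableSet) C
    ((ae_restrict_iff' hK.measurableSet).2 (ae_of_all _ hC))

/-- Change of variables for the image of a measure with nonnegative density. -/
theorem integral_map_withDensity_ofReal {X Y : Type*} [MeasurableSpace X] [MeasurableSpace Y]
    {ν : Measure X} {π : X → ℝ} (hπ : Measurable π) (h0 : ∀ x, 0 ≤ π x) {e : X → Y}
    (he : Measurable e) {a : Y → ℝ}
    (ha : AEStronglyMeasurable a
      (Measure.map e (ν.withDensity fun x => ENNReal.ofReal (π x)))) :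
    ∫ y, a y ∂(Measure.map e (ν.withDensity fun x => ENNReal.ofReal (π x))) =
      ∫ x, a (e x) * π x ∂ν := by
  rw [integral_map he.aemeasurable ha,
    integral_withDensity_eq_integral_toReal_smul hπ.ennreal_ofReal
      (ae_of_all _ fun _ => ENNReal.ofReal_lt_top)]
  refine integral_congr_ae (ae_of_all _ fun x => ?_)
  simp only [ENNReal.toReal_ofReal (h0 x), smul_eq_mul, mul_comm]

section

variable {n : ℕ} {Ω₁ Ω₂ : Set (Fin n → ℝ)} {μ₁ μ₂ : Measure (Fin n → ℝ)}
  {c π : (Fin n → ℝ) × (Fin n → ℝ) → ℝ} {γ : ℝ} {α₁ α₂ : (Fin n → ℝ) → ℝ}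

theorem measure_restrict_eq_self {Y : Type*} [MeasurableSpace Y] {μ : Measure Y} {K : Set Y}
    (h : μ Kᶜ = 0) : μ.restrict K = μ :=
  Measure.restrict_eq_self_of_ae_mem (by rwa [ae_iff])

theorem IsFeasiblePlan.setIntegral_fst (h : IsFeasiblePlan Ω₁ Ω₂ μ₁ μ₂ π)
    [IsFiniteMeasure μ₁] (hΩ₁ : IsCompact Ω₁) (hμ₁ : μ₁ Ω₁ᶜ = 0) (hα : ContinuousOn α₁ Ω₁) :
    ∫ x in Ω₁, α₁ x ∂μ₁ = ∫ x in Ω₁ ×ˢ Ω₂, α₁ x.1 * π x := by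
  obtain ⟨hm, h0, h1, -⟩ := h
  have ha := (memLp_restrict_of_continuousOn (μ := μ₁) hΩ₁ hα 2).1
  rw [measure_restrict_eq_self hμ₁] at ha ⊢
  rw [← integral_map_withDensity_ofReal hm h0 measurable_fst (by rwa [h1]), h1]

theorem IsFeasiblePlan.setIntegral_snd (h : IsFeasiblePlan Ω₁ Ω₂ μ₁ μ₂ π)
    [IsFiniteMeasure μ₂] (hΩ₂ : IsCompact Ω₂) (hμ₂ : μ₂ Ω₂ᶜ = 0) (hα : ContinuousOn α₂ Ω₂) :
    ∫ x in Ω₂, α₂ x ∂μ₂ = ∫ x in Ω₁ ×ˢ Ω₂, α₂ x.2 * π x := by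
  obtain ⟨hm, h0, -, h2⟩ := h
  have ha := (memLp_restrict_of_continuousOn (μ := μ₂) hΩ₂ hα 2).1
  rw [measure_restrict_eq_self hμ₂] at ha ⊢
  rw [← integral_map_withDensity_ofReal hm h0 measurable_snd (by rwa [h2]), h2]

theorem primalValueQuad_of_memLp (h0 : ∀ x, 0 ≤ π x)
    (hL : MemLp π 2 (volume.restrict (Ω₁ ×ˢ Ω₂))) :
    primalValueQuad Ω₁ Ω₂ c γ π =
      ((∫ x in Ω₁ ×ˢ Ω₂, c x * π x) + γ / 2 * ∫ x in Ω₁ ×ˢ Ω₂, π x ^ 2 : ℝ) := by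
  have hsq := (memLp_two_iff_integrable_sq hL.1).1 hL
  have hlin : ∫⁻ x in Ω₁ ×ˢ Ω₂, ENNReal.ofReal (π x) ^ 2 =
      ENNReal.ofReal (∫ x in Ω₁ ×ˢ Ω₂, π x ^ 2) := by
    rw [ofReal_integral_eq_lintegral_ofReal hsq (ae_of_all _ fun x => sq_nonneg _)]
    exact lintegral_congr fun x => (ENNReal.ofReal_pow (h0 x) 2).symm
  rw [primalValueQuad, hlin, EReal.coe_ennreal_ofReal,
    max_eq_left (integral_nonneg fun x => sq_nonneg _)]
  norm_cast

theorem primalValueQuad_of_not_memLp (hγ : 0 < γ) (hm : Measurable π) (h0 : ∀ x, 0 ≤ π x)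
    (hL : ¬ MemLp π 2 (volume.restrict (Ω₁ ×ˢ Ω₂))) :
    primalValueQuad Ω₁ Ω₂ c γ π = ⊤ := by
  have htop : ∫⁻ x in Ω₁ ×ˢ Ω₂, ENNReal.ofReal (π x) ^ 2 = ⊤ := by
    by_contra hne
    refine hL ((memLp_two_iff_integrable_sq hm.aestronglyMeasurable).2
      ⟨(hm.pow_const 2).aestronglyMeasurable, ?_⟩)
    rw [hasFiniteIntegral_iff_ofReal (ae_of_all _ fun x => sq_nonneg _)]
    refine lt_of_le_of_lt (le_of_eq ?_) (lt_top_iff_ne_top.2 hne)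
    exact lintegral_congr fun x => ENNReal.ofReal_pow (h0 x) 2
  rw [primalValueQuad, htop, EReal.coe_ennreal_top, EReal.coe_mul_top_of_pos (by positivity),
    EReal.coe_add_top]

theorem memLp_dual_slack (hΩ₁ : IsCompact Ω₁) (hΩ₂ : IsCompact Ω₂)
    (hc : ContinuousOn c (Ω₁ ×ˢ Ω₂)) (hα₁ : ContinuousOn α₁ Ω₁) (hα₂ : ContinuousOn α₂ Ω₂) :
    MemLp (fun x : (Fin n → ℝ) × (Fin n → ℝ) => max (α₁ x.1 + α₂ x.2 - c x) 0) 2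
      (volume.restrict (Ω₁ ×ˢ Ω₂)) := by
  refine memLp_restrict_of_continuousOn (hΩ₁.prod hΩ₂) ?_ 2
  have h1 : ContinuousOn (fun x : (Fin n → ℝ) × (Fin n → ℝ) => α₁ x.1) (Ω₁ ×ˢ Ω₂) :=
    hα₁.comp continuousOn_fst fun _ hx => hx.1
  have h2 : ContinuousOn (fun x : (Fin n → ℝ) × (Fin n → ℝ) => α₂ x.2) (Ω₁ ×ˢ Ω₂) :=
    hα₂.comp continuousOn_snd fun _ hx => hx.2
  exact ((h1.add h2).sub hc).sup continuousOn_const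

/-- Weak duality. -/
theorem IsFeasiblePlan.dualValueQuad_le (h : IsFeasiblePlan Ω₁ Ω₂ μ₁ μ₂ π)
    [IsFiniteMeasure μ₁] [IsFiniteMeasure μ₂] (hΩ₁ : IsCompact Ω₁) (hΩ₂ : IsCompact Ω₂)
    (hμ₁ : μ₁ Ω₁ᶜ = 0) (hμ₂ : μ₂ Ω₂ᶜ = 0) (hc : ContinuousOn c (Ω₁ ×ˢ Ω₂)) (hγ : 0 < γ)
    (hα₁ : ContinuousOn α₁ Ω₁) (hα₂ : ContinuousOn α₂ Ω₂) :
    ((dualValueQuad Ω₁ Ω₂ μ₁ μ₂ c γ α₁ α₂ : ℝ) : EReal) ≤ primalValueQuad Ω₁ Ω₂ c γ π := by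
  by_cases hL : MemLp π 2 (volume.restrict (Ω₁ ×ˢ Ω₂))
  swap
  · rw [primalValueQuad_of_not_memLp hγ h.1 h.2.1 hL]; exact le_top
  rw [primalValueQuad_of_memLp h.2.1 hL, EReal.coe_le_coe_iff, dualValueQuad,
    h.setIntegral_fst hΩ₁ hμ₁ hα₁, h.setIntegral_snd hΩ₂ hμ₂ hα₂]
  have i1 : Integrable (fun x => α₁ x.1 * π x) (volume.restrict (Ω₁ ×ˢ Ω₂)) :=
    (memLp_restrict_of_continuousOn (hΩ₁.prod hΩ₂)
      (hα₁.comp continuousOn_fst fun _ hx => hx.1) 2).integrable_mul hL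
  have i2 : Integrable (fun x => α₂ x.2 * π x) (volume.restrict (Ω₁ ×ˢ Ω₂)) :=
    (memLp_restrict_of_continuousOn (hΩ₁.prod hΩ₂)
      (hα₂.comp continuousOn_snd fun _ hx => hx.2) 2).integrable_mul hL
  have ic : Integrable (fun x => c x * π x) (volume.restrict (Ω₁ ×ˢ Ω₂)) :=
    (memLp_restrict_of_continuousOn (hΩ₁.prod hΩ₂) hc 2).integrable_mul hL
  have i12 : Integrable (fun x => α₁ x.1 * π x + α₂ x.2 * π x)
      (volume.restrict (Ω₁ ×ˢ Ω₂)) := i1.add i2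
  have iπ := hL.integrable_sq
  have is := (memLp_dual_slack hΩ₁ hΩ₂ hc hα₁ hα₂).integrable_sq
  rw [← integral_const_mul, ← integral_const_mul, ← integral_add i1 i2,
    ← integral_sub i12 (is.const_mul _), ← integral_add ic (iπ.const_mul _)]
  refine integral_mono (i12.sub (is.const_mul _)) (ic.add (iπ.const_mul _)) fun x => ?_
  have hs := mul_le_mul_of_nonneg_right (le_max_left (α₁ x.1 + α₂ x.2 - c x) 0) (h.2.1 x)
  set s := max (α₁ x.1 + α₂ x.2 - c x) 0
  have hsq : s * π x ≤ 1 / (2 * γ) * s ^ 2 + γ / 2 * π x ^ 2 := by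
    have h3 : 0 ≤ 1 / (2 * γ) * (s - γ * π x) ^ 2 := by positivity
    have h4 : 1 / (2 * γ) * (s - γ * π x) ^ 2 =
        1 / (2 * γ) * s ^ 2 + γ / 2 * π x ^ 2 - s * π x := by
      field_simp; ring
    linarith
  simp only
  linarith

/-- The subspace of pairs `(α₁ ⊕ α₂, ∫ α₁ dμ₁ + ∫ α₂ dμ₂)` with continuous `α₁, α₂`. -/
def dualGraph (hΩ₁ : IsCompact Ω₁) (hΩ₂ : IsCompact Ω₂) (μ₁ μ₂ : Measure (Fin n → ℝ))
    [IsFiniteMeasure μ₁] [IsFiniteMeasure μ₂] :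
    Submodule ℝ (Lp ℝ 2 (volume.restrict (Ω₁ ×ˢ Ω₂)) × ℝ) where
  carrier := {q | ∃ α₁ α₂ : (Fin n → ℝ) → ℝ, ContinuousOn α₁ Ω₁ ∧ ContinuousOn α₂ Ω₂ ∧
    q.1 =ᵐ[volume.restrict (Ω₁ ×ˢ Ω₂)] (fun x => α₁ x.1 + α₂ x.2) ∧
    q.2 = ∫ x in Ω₁, α₁ x ∂μ₁ + ∫ x in Ω₂, α₂ x ∂μ₂}
  zero_mem' := by
    refine ⟨0, 0, continuousOn_const, continuousOn_const, ?_, by simp⟩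
    filter_upwards [Lp.coeFn_zero ℝ 2 (volume.restrict (Ω₁ ×ˢ Ω₂))] with x hx
    simpa using hx
  add_mem' := by
    rintro ⟨f, s⟩ ⟨g, t⟩ ⟨α₁, α₂, h1, h2, hf, hs⟩ ⟨β₁, β₂, k1, k2, hg, ht⟩
    refine ⟨α₁ + β₁, α₂ + β₂, h1.add k1, h2.add k2, ?_, ?_⟩
    · filter_upwards [Lp.coeFn_add f g, hf, hg] with x hx hfx hgx
      simp only [Prod.mk_add_mk, hx, Pi.add_apply]
      rw [hfx, hgx]; ring
    · simp only at hs ht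
      simp only [Prod.mk_add_mk, Pi.add_apply]
      rw [integral_add, integral_add, hs, ht]
      · ring
      · exact (memLp_restrict_of_continuousOn hΩ₂ h2 1).integrable le_rfl
      · exact (memLp_restrict_of_continuousOn hΩ₂ k2 1).integrable le_rfl
      · exact (memLp_restrict_of_continuousOn hΩ₁ h1 1).integrable le_rfl
      · exact (memLp_restrict_of_continuousOn hΩ₁ k1 1).integrable le_rfl
  smul_mem' := by
    rintro r ⟨f, s⟩ ⟨α₁, α₂, h1, h2, hf, hs⟩
    refine ⟨r • α₁, r • α₂, h1.const_smul r, h2.const_smul r, ?_, ?_⟩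
    · filter_upwards [Lp.coeFn_smul r f, hf] with x hx hfx
      simp only [Prod.smul_mk, hx, Pi.smul_apply, smul_eq_mul]
      rw [hfx]; ring
    · simp only at hs
      simp only [Prod.smul_mk, Pi.smul_apply, smul_eq_mul]
      rw [integral_const_mul, integral_const_mul, hs]; ring

theorem memLp_add_of_continuousOn (hΩ₁ : IsCompact Ω₁) (hΩ₂ : IsCompact Ω₂)
    (hα₁ : ContinuousOn α₁ Ω₁) (hα₂ : ContinuousOn α₂ Ω₂) :
    MemLp (fun x : (Fin n → ℝ) × (Fin n → ℝ) => α₁ x.1 + α₂ x.2) 2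
      (volume.restrict (Ω₁ ×ˢ Ω₂)) :=
  memLp_restrict_of_continuousOn (hΩ₁.prod hΩ₂)
    ((hα₁.comp continuousOn_fst fun _ hx => hx.1).add
      (hα₂.comp continuousOn_snd fun _ hx => hx.2)) 2

/-- If the dual objective is bounded above by `M`, some feasible plan has primal value at most
`M`. -/
theorem exists_isFeasiblePlan_le [IsFiniteMeasure μ₁] [IsFiniteMeasure μ₂]
    (hΩ₁ : IsCompact Ω₁) (hΩ₂ : IsCompact Ω₂) (hμ₁ : μ₁ Ω₁ᶜ = 0) (hμ₂ : μ₂ Ω₂ᶜ = 0)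
    (hc : ContinuousOn c (Ω₁ ×ˢ Ω₂)) (hγ : 0 < γ) {M : ℝ}
    (hM : ∀ α₁ α₂ : (Fin n → ℝ) → ℝ, ContinuousOn α₁ Ω₁ → ContinuousOn α₂ Ω₂ →
      dualValueQuad Ω₁ Ω₂ μ₁ μ₂ c γ α₁ α₂ ≤ M) :
    ∃ π, IsFeasiblePlan Ω₁ Ω₂ μ₁ μ₂ π ∧ primalValueQuad Ω₁ Ω₂ c γ π ≤ M := by
  have hcL := memLp_restrict_of_continuousOn (μ := volume) (hΩ₁.prod hΩ₂) hc 2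
  have hcc := hcL.coeFn_toLp
  have : IsFiniteMeasure ((volume : Measure ((Fin n → ℝ) × (Fin n → ℝ))).restrict (Ω₁ ×ˢ Ω₂)) :=
    isFiniteMeasure_restrict.2 (hΩ₁.prod hΩ₂).measure_ne_top
  obtain ⟨p, hp0, hpB, hpM⟩ := exists_nonneg_representative (hcL.toLp c) hγ M
    (dualGraph hΩ₁ hΩ₂ μ₁ μ₂) (by
      rintro ⟨f, t⟩ ⟨α₁, α₂, h1, h2, hf, ht⟩
      simp only at hf ht ⊢
      have h := hM α₁ α₂ h1 h2
      have heq : ‖Lp.posPart (f - hcL.toLp c)‖ ^ 2 =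
          ∫ x in Ω₁ ×ˢ Ω₂, max (α₁ x.1 + α₂ x.2 - c x) 0 ^ 2 := by
        rw [Lp.norm_sq_eq_integral]
        refine integral_congr_ae ?_
        filter_upwards [Lp.coeFn_posPart (f - hcL.toLp c), Lp.coeFn_sub f (hcL.toLp c), hf, hcc]
          with x k1 k2 k3 k4
        rw [k1, k2, Pi.sub_apply, k3, k4]
      rw [dualValueQuad, ← heq, ← ht] at h
      linarith)
  have hpm : Measurable (p : (Fin n → ℝ) × (Fin n → ℝ) → ℝ) := (Lp.stronglyMeasurable p).measurable
  set π : (Fin n → ℝ) × (Fin n → ℝ) → ℝ := fun x => max (p x) 0 with hπ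
  have hπm : Measurable π := hpm.max measurable_const
  have hπ0 : ∀ x, 0 ≤ π x := fun x => le_max_right _ _
  have hπp : p =ᵐ[volume.restrict (Ω₁ ×ˢ Ω₂)] π := by
    filter_upwards [hp0] with x hx
    exact (max_eq_left hx).symm
  have hπL : MemLp π 2 (volume.restrict (Ω₁ ×ˢ Ω₂)) := (memLp_congr_ae hπp).1 (Lp.memLp p)
  have hfin : IsFiniteMeasure
      ((volume.restrict (Ω₁ ×ˢ Ω₂)).withDensity fun x => ENNReal.ofReal (π x)) :=
    isFiniteMeasure_withDensity_ofReal (hπL.integrable one_le_two).2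
  have hpair : ∀ α₁ α₂ : (Fin n → ℝ) → ℝ, Continuous α₁ → Continuous α₂ →
      ∫ x in Ω₁ ×ˢ Ω₂, (α₁ x.1 + α₂ x.2) * π x = ∫ x, α₁ x ∂μ₁ + ∫ x, α₂ x ∂μ₂ := by
    intro α₁ α₂ h1 h2
    have hL := memLp_add_of_continuousOn hΩ₁ hΩ₂ h1.continuousOn h2.continuousOn
    have h := hpB (hL.toLp _, ∫ x in Ω₁, α₁ x ∂μ₁ + ∫ x in Ω₂, α₂ x ∂μ₂)
      ⟨α₁, α₂, h1.continuousOn, h2.continuousOn, hL.coeFn_toLp, rfl⟩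
    rw [measure_restrict_eq_self hμ₁, measure_restrict_eq_self hμ₂, L2.inner_def] at h
    refine Eq.trans (integral_congr_ae ?_) h
    filter_upwards [hL.coeFn_toLp, hπp] with x k1 k2
    simp only [RCLike.inner_apply, conj_trivial, k1, k2]
  refine ⟨π, ⟨hπm, hπ0, ?_, ?_⟩, ?_⟩
  · refine ext_of_forall_integral_eq_of_IsFiniteMeasure fun a => ?_
    rw [integral_map_withDensity_ofReal hπm hπ0 measurable_fst
      a.continuous.measurable.aestronglyMeasurable]
    simpa using hpair a 0 a.continuous continuous_zero
  · refine ext_of_forall_integral_eq_of_IsFiniteMeasure fun a => ?_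
    rw [integral_map_withDensity_ofReal hπm hπ0 measurable_snd
      a.continuous.measurable.aestronglyMeasurable]
    simpa using hpair 0 a continuous_zero a.continuous
  · rw [primalValueQuad_of_memLp hπ0 hπL, EReal.coe_le_coe_iff]
    rw [L2.inner_def, Lp.norm_sq_eq_integral] at hpM
    refine le_of_eq_of_le (congrArg₂ (· + γ / 2 * ·) ?_ ?_) hpM
    · refine integral_congr_ae ?_
      filter_upwards [hcc, hπp] with x k1 k2
      simp only [RCLike.inner_apply, conj_trivial, k1, k2]
    · refine integral_congr_ae ?_
      filter_upwards [hπp] with x k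
      rw [k]

end

/-- Strong duality for quadratically regularized optimal transport, and attainment of the
infimum when the supremum is finite. -/
theorem strong_duality_quadratic {n : ℕ}
    (Ω₁ Ω₂ : Set (Fin n → ℝ)) (hΩ₁ : IsCompact Ω₁) (hΩ₂ : IsCompact Ω₂)
    (μ₁ μ₂ : Measure (Fin n → ℝ)) [IsFiniteMeasure μ₁] [IsFiniteMeasure μ₂]
    (hμ₁ : μ₁ Ω₁ᶜ = 0) (hμ₂ : μ₂ Ω₂ᶜ = 0) (hmass : μ₁ Ω₁ = μ₂ Ω₂)
    (c : (Fin n → ℝ) × (Fin n → ℝ) → ℝ) (hc : ContinuousOn c (Ω₁ ×ˢ Ω₂))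
    (γ : ℝ) (hγ : 0 < γ) :
    sInf {v : EReal | ∃ π, IsFeasiblePlan Ω₁ Ω₂ μ₁ μ₂ π ∧ v = primalValueQuad Ω₁ Ω₂ c γ π} =
      sSup {v : EReal | ∃ α₁ α₂ : (Fin n → ℝ) → ℝ, ContinuousOn α₁ Ω₁ ∧ ContinuousOn α₂ Ω₂ ∧
        v = ((dualValueQuad Ω₁ Ω₂ μ₁ μ₂ c γ α₁ α₂ : ℝ) : EReal)} ∧
    (sSup {v : EReal | ∃ α₁ α₂ : (Fin n → ℝ) → ℝ, ContinuousOn α₁ Ω₁ ∧ ContinuousOn α₂ Ω₂ ∧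
        v = ((dualValueQuad Ω₁ Ω₂ μ₁ μ₂ c γ α₁ α₂ : ℝ) : EReal)} ≠ ⊤ →
      ∃ π, IsFeasiblePlan Ω₁ Ω₂ μ₁ μ₂ π ∧
        primalValueQuad Ω₁ Ω₂ c γ π =
          sInf {v : EReal | ∃ π', IsFeasiblePlan Ω₁ Ω₂ μ₁ μ₂ π' ∧
            v = primalValueQuad Ω₁ Ω₂ c γ π'}) := by
  have hweak : ∀ π, IsFeasiblePlan Ω₁ Ω₂ μ₁ μ₂ π →
      sSup {v : EReal | ∃ α₁ α₂ : (Fin n → ℝ) → ℝ, ContinuousOn α₁ Ω₁ ∧ ContinuousOn α₂ Ω₂ ∧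
        v = ((dualValueQuad Ω₁ Ω₂ μ₁ μ₂ c γ α₁ α₂ : ℝ) : EReal)} ≤
      primalValueQuad Ω₁ Ω₂ c γ π := by
    rintro π hπ
    refine sSup_le ?_
    rintro _ ⟨α₁, α₂, h1, h2, rfl⟩
    exact hπ.dualValueQuad_le hΩ₁ hΩ₂ hμ₁ hμ₂ hc hγ h1 h2
  have hle := fun (α₁ α₂ : (Fin n → ℝ) → ℝ) (h1 : ContinuousOn α₁ Ω₁)
    (h2 : ContinuousOn α₂ Ω₂) =>
    le_sSup (show ((dualValueQuad Ω₁ Ω₂ μ₁ μ₂ c γ α₁ α₂ : ℝ) : EReal) ∈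
      {v : EReal | ∃ α₁ α₂ : (Fin n → ℝ) → ℝ, ContinuousOn α₁ Ω₁ ∧ ContinuousOn α₂ Ω₂ ∧
        v = ((dualValueQuad Ω₁ Ω₂ μ₁ μ₂ c γ α₁ α₂ : ℝ) : EReal)} from ⟨α₁, α₂, h1, h2, rfl⟩)
  set S := sSup {v : EReal | ∃ α₁ α₂ : (Fin n → ℝ) → ℝ, ContinuousOn α₁ Ω₁ ∧
    ContinuousOn α₂ Ω₂ ∧ v = ((dualValueQuad Ω₁ Ω₂ μ₁ μ₂ c γ α₁ α₂ : ℝ) : EReal)}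
  have hinf : S ≤ sInf {v : EReal | ∃ π, IsFeasiblePlan Ω₁ Ω₂ μ₁ μ₂ π ∧
      v = primalValueQuad Ω₁ Ω₂ c γ π} := by
    refine le_sInf ?_
    rintro _ ⟨π, hπ, rfl⟩
    exact hweak π hπ
  have hstrong : S ≠ ⊤ → ∃ π, IsFeasiblePlan Ω₁ Ω₂ μ₁ μ₂ π ∧
      primalValueQuad Ω₁ Ω₂ c γ π ≤ S := by
    intro hS
    have hbot : S ≠ ⊥ := by
      intro hb
      have h := hle 0 0 continuousOn_const continuousOn_const
      rw [hb, le_bot_iff] at h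
      exact EReal.coe_ne_bot _ h
    obtain ⟨M, hSM⟩ : ∃ M : ℝ, (M : EReal) = S := ⟨S.toReal, EReal.coe_toReal hS hbot⟩
    rw [← hSM] at hle ⊢
    exact exists_isFeasiblePlan_le hΩ₁ hΩ₂ hμ₁ hμ₂ hc hγ fun α₁ α₂ h1 h2 =>
      EReal.coe_le_coe_iff.1 (hle α₁ α₂ h1 h2)
  refine ⟨le_antisymm ?_ hinf, fun hS => ?_⟩
  · by_cases hS : S = ⊤
    · rw [hS]; exact le_top
    · obtain ⟨π, hπ, hπS⟩ := hstrong hS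
      exact sInf_le_of_le ⟨π, hπ, rfl⟩ hπS
  · obtain ⟨π, hπ, hπS⟩ := hstrong hS
    exact ⟨π, hπ, le_antisymm (hπS.trans hinf) (sInf_le ⟨π, hπ, rfl⟩)⟩
end

section
/- Strong duality for entropically regularized optimal transport: let Ω₁, Ω₂ ⊂ ℝⁿ be compact, Ω := Ω₁ × Ω₂, let μ₁, μ₂ be finite nonnegative Borel measures on Ω₁, Ω₂ with μ₁(Ω₁) = μ₂(Ω₂), let c : Ω → ℝ be continuous and γ > 0. Then the infimum of ∫_Ω c·π dx + γ·∫_Ω π log π dx (with 0·log 0 := 0) over all measurable π : Ω → [0,∞) such that the measure π dx has marginals μ₁ and μ₂ equals the supremum of ∫_{Ω₁} α₁ dμ₁ + ∫_{Ω₂} α₂ dμ₂ − γ·∫_Ω exp((α₁(x₁) + α₂(x₂) − c(x₁,x₂))/γ − 1) dx over all continuous α₁ : Ω₁ → ℝ and α₂ : Ω₂ → ℝ. Moreover, if the supremum is finite, the infimum is attained. -/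
open MeasureTheory Set ENNReal NNReal

/-- The entropically regularized primal objective `∫_Ω c π dx + γ ∫_Ω π log π dx`
(with `0 log 0 := 0`), as an extended real number: the entropy integral is split into its
positive and negative parts (the negative part is always finite on a bounded domain). -/
noncomputable def primalValueEnt {n : ℕ} (Ω₁ Ω₂ : Set (Fin n → ℝ))
    (c : (Fin n → ℝ) × (Fin n → ℝ) → ℝ) (γ : ℝ)
    (π : (Fin n → ℝ) × (Fin n → ℝ) → ℝ) : EReal :=
  ((∫ x in Ω₁ ×ˢ Ω₂, c x * π x : ℝ) : EReal) +
    (γ : ℝ) * ((∫⁻ x in Ω₁ ×ˢ Ω₂, ENNReal.ofReal (π x * Real.log (π x))).toEReal -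
      (∫⁻ x in Ω₁ ×ˢ Ω₂, ENNReal.ofReal (-(π x * Real.log (π x)))).toEReal)

/-- The entropic dual objective
`∫_{Ω₁} α₁ dμ₁ + ∫_{Ω₂} α₂ dμ₂ − γ ∫_Ω exp((α₁ ⊕ α₂ − c)/γ − 1) dx`. -/
noncomputable def dualValueEnt {n : ℕ} (Ω₁ Ω₂ : Set (Fin n → ℝ))
    (μ₁ μ₂ : Measure (Fin n → ℝ)) (c : (Fin n → ℝ) × (Fin n → ℝ) → ℝ) (γ : ℝ)
    (α₁ α₂ : (Fin n → ℝ) → ℝ) : ℝ :=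
  ∫ x in Ω₁, α₁ x ∂μ₁ + ∫ x in Ω₂, α₂ x ∂μ₂ -
    γ * ∫ x in Ω₁ ×ˢ Ω₂, Real.exp ((α₁ x.1 + α₂ x.2 - c x) / γ - 1)

section

open Filter Topology

/-- A linear functional dominated by a convex function along a linear map factors through a linear
functional dominated by that convex function. -/
theorem exists_linearMap_comp_eq_le_convex {A E : Type*} [AddCommGroup A] [Module ℝ A]
    [AddCommGroup E] [Module ℝ E] (T : A →ₗ[ℝ] E) (L : A →ₗ[ℝ] ℝ) (F : E → ℝ)
    (hF : ConvexOn ℝ univ F) (h : ∀ a, L a ≤ F (T a)) :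
    ∃ ℓ : E →ₗ[ℝ] ℝ, (∀ a, ℓ (T a) = L a) ∧ ∀ x, ℓ x ≤ F x := by
  obtain ⟨f, hf⟩ : ∃ f : E →ₗ[ℝ] ℝ, ∀ a, f (T a) = L a := by
    have hL : L ∈ LinearMap.range T.dualMap := by
      rw [LinearMap.range_dualMap_eq_dualAnnihilator_ker, Submodule.mem_dualAnnihilator]
      intro a ha
      rw [LinearMap.mem_ker] at ha
      by_contra hne
      have h1 := h (((F 0 + 1) / L a) • a)
      rw [map_smul, map_smul, ha, smul_zero, smul_eq_mul, div_mul_cancel₀ _ hne] at h1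
      linarith
    obtain ⟨f, rfl⟩ := hL
    exact ⟨f, fun a => rfl⟩
  let K : PointedCone ℝ (E × ℝ × ℝ) :=
    { carrier := {p | p = 0 ∨ 0 < p.2.2 ∧ p.2.2 * F (p.2.2⁻¹ • p.1) ≤ p.2.1}
      zero_mem' := Or.inl rfl
      add_mem' := by
        rintro ⟨x, r, t⟩ ⟨y, s, u⟩ (hp | ⟨ht, hp⟩) (hq | ⟨hu, hq⟩)
        · left; rw [hp, hq, add_zero]
        · right; rw [hp, zero_add]; exact ⟨hu, hq⟩
        · right; rw [hq, add_zero]; exact ⟨ht, hp⟩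
        · right
          simp only [Prod.mk_add_mk] at *
          refine ⟨by positivity, ?_⟩
          have hc := hF.2 (mem_univ (t⁻¹ • x)) (mem_univ (u⁻¹ • y))
            (show 0 ≤ t / (t + u) by positivity) (show 0 ≤ u / (t + u) by positivity)
            (by field_simp)
          have e : (t / (t + u)) • t⁻¹ • x + (u / (t + u)) • u⁻¹ • y = (t + u)⁻¹ • (x + y) := by
            rw [smul_smul, smul_smul, smul_add]
            congr 2 <;> field_simp
          rw [e, smul_eq_mul, smul_eq_mul] at hc
          have := mul_le_mul_of_nonneg_left hc (show 0 ≤ t + u by positivity)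
          have e2 : (t + u) * (t / (t + u) * F (t⁻¹ • x) + u / (t + u) * F (u⁻¹ • y)) =
              t * F (t⁻¹ • x) + u * F (u⁻¹ • y) := by field_simp
          linarith
      smul_mem' := by
        rintro ⟨k, hk⟩ ⟨x, r, t⟩ (hp | ⟨ht, hp⟩)
        · left; rw [hp, smul_zero]
        · rcases hk.eq_or_lt with rfl | hk'
          · left
            exact zero_smul ℝ (x, r, t)
          · right
            change 0 < k * t ∧ (k * t) * F ((k * t)⁻¹ • k • x) ≤ k * r
            refine ⟨mul_pos hk' ht, ?_⟩
            rw [smul_smul, show (k * t)⁻¹ * k = t⁻¹ by field_simp, mul_assoc]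
            exact mul_le_mul_of_nonneg_left hp hk }
  let G : E × ℝ × ℝ →ₗ[ℝ] ℝ :=
    (LinearMap.fst ℝ ℝ ℝ).comp (LinearMap.snd ℝ E (ℝ × ℝ)) - f.comp (LinearMap.fst ℝ E (ℝ × ℝ))
  let D : Submodule ℝ (E × ℝ × ℝ) := (LinearMap.range T).prod ⊤
  obtain ⟨g, hg, hgK⟩ := riesz_extension K ⟨D, G.domRestrict D⟩ (by
      rintro ⟨⟨x, r, t⟩, ⟨⟨a, ha⟩, _⟩⟩ hK
      change T a = x at ha
      subst ha
      change 0 ≤ r - f (T a)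
      rcases (hK : (T a, r, t) = 0 ∨ 0 < t ∧ t * F (t⁻¹ • T a) ≤ r) with hp | ⟨ht, hp⟩
      · simp only [Prod.mk_eq_zero] at hp
        simp [hp.1, hp.2.1]
      · have h1 := h (t⁻¹ • a)
        rw [map_smul, map_smul, smul_eq_mul] at h1
        have := mul_le_mul_of_nonneg_left h1 ht.le
        rw [mul_inv_cancel_left₀ ht.ne'] at this
        rw [hf]
        linarith)
    (by
      rintro ⟨x, r, t⟩
      refine ⟨⟨(0, F x - r, 1 - t), ⟨zero_mem _, trivial⟩⟩, Or.inr ?_⟩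
      simp)
  have hG : ∀ p (hp : p ∈ D), g p = G p := fun p hp => hg ⟨p, hp⟩
  refine ⟨-(g.comp (LinearMap.inl ℝ E (ℝ × ℝ))), fun a => ?_, fun x => ?_⟩
  · have := hG (T a, 0, 0) ⟨⟨a, rfl⟩, trivial⟩
    change -g (T a, 0, 0) = L a
    rw [this]
    simp [G, hf]
  · have h1 := hgK (x, F x, 1) (Or.inr (by simp))
    have h2 := hG (0, F x, 1) ⟨zero_mem _, trivial⟩
    have h3 : g (x, F x, 1) = g (x, 0, 0) + g (0, F x, 1) := by
      rw [← map_add]; simp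
    simp [G] at h2
    change -g (x, 0, 0) ≤ F x
    linarith

section Density

variable {X : Type*} [MeasurableSpace X]

/-- The essentially bounded functions, as a space of functions rather than of classes. -/
def essBounded (m : Measure X) : Submodule ℝ (X → ℝ) where
  carrier := {f | MemLp f ∞ m}
  add_mem' hf hg := MemLp.add hf hg
  zero_mem' := MemLp.zero
  smul_mem' k _ hf := MemLp.const_smul hf k

theorem MeasureTheory.MemLp.exists_ae_norm_le {m : Measure X} {f : X → ℝ} (hf : MemLp f ∞ m) :
    ∃ C, 0 ≤ C ∧ ∀ᵐ x ∂m, ‖f x‖ ≤ C := by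
  refine ⟨(eLpNormEssSup f m).toReal, ENNReal.toReal_nonneg, ?_⟩
  have h : eLpNormEssSup f m ≠ ∞ := by
    have := hf.2
    rw [eLpNorm_exponent_top] at this
    exact this.ne
  filter_upwards [ae_le_eLpNormEssSup (f := f) (μ := m)] with x hx
  rw [← toReal_enorm]
  exact ENNReal.toReal_mono h hx

/-- The indicator of a measurable set as an essentially bounded function. -/
noncomputable def essIndicator (m : Measure X) [IsFiniteMeasure m] (s : Set X)
    (hs : MeasurableSet s) : essBounded m :=
  ⟨s.indicator 1, memLp_indicator_const ∞ hs 1 (Or.inr (measure_ne_top _ _))⟩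

/-- A positive linear functional on essentially bounded functions that is continuous under bounded
almost everywhere convergence is given by an integrable density. -/
theorem exists_density_of_positive_of_continuous {m : Measure X} [IsFiniteMeasure m]
    (ℓ : essBounded m →ₗ[ℝ] ℝ) (hpos : ∀ f : essBounded m, (∀ x, 0 ≤ f.1 x) → 0 ≤ ℓ f)
    (hcont : ∀ (C : ℝ) (F : ℕ → essBounded m) (f : essBounded m),
      (∀ k, ∀ᵐ x ∂m, ‖(F k).1 x‖ ≤ C) →
      (∀ᵐ x ∂m, Tendsto (fun k => (F k).1 x) atTop (𝓝 (f.1 x))) →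
      Tendsto (fun k => ℓ (F k)) atTop (𝓝 (ℓ f))) :
    ∃ p : X → ℝ, Measurable p ∧ (∀ x, 0 ≤ p x) ∧ Integrable p m ∧
      ∀ f : essBounded m, ℓ f = ∫ x, p x * f.1 x ∂m := by
  have hcongr : ∀ f g : essBounded m, f.1 =ᵐ[m] g.1 → ℓ f = ℓ g := by
    intro f g hfg
    obtain ⟨C, -, hC⟩ := f.2.exists_ae_norm_le
    refine tendsto_nhds_unique tendsto_const_nhds
      (hcont C (fun _ => f) g (fun _ => hC) ?_)
    filter_upwards [hfg] with x hx
    rw [hx]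
    exact tendsto_const_nhds
  have hindpos : ∀ s hs, 0 ≤ ℓ (essIndicator m s hs) := fun s hs =>
    hpos _ fun x => indicator_nonneg (fun _ _ => zero_le_one) x
  let ν : Measure X := Measure.ofMeasurable
    (fun s hs => ENNReal.ofReal (ℓ (essIndicator m s hs)))
    (by
      have : essIndicator m ∅ MeasurableSet.empty = 0 := by ext x; simp [essIndicator]
      simp [this])
    (by
      intro s hs hd
      have hsum : HasSum (fun i => ℓ (essIndicator m (s i) (hs i)))
          (ℓ (essIndicator m (⋃ i, s i) (MeasurableSet.iUnion hs))) := by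
        rw [hasSum_iff_tendsto_nat_of_nonneg (fun i => hindpos _ _)]
        simp_rw [← map_sum]
        have hval : ∀ k x, (∑ i ∈ Finset.range k, essIndicator m (s i) (hs i)).1 x =
            (⋃ i ∈ Finset.range k, s i).indicator (1 : X → ℝ) x := by
          intro k x
          rw [Finset.indicator_biUnion _ _ (fun i _ j _ hij => hd hij)]
          simp [essIndicator]
        refine hcont 1 _ _ (fun k => ae_of_all _ fun x => ?_) (ae_of_all _ fun x => ?_)
        · rw [hval]
          by_cases hx : x ∈ ⋃ i ∈ Finset.range k, s i <;> simp only [hx, indicator_of_mem,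
            indicator_of_notMem, not_false_eq_true] <;> simp
        · simp_rw [hval]
          exact ((tendsto_indicator_biUnion_finset s 1 x).comp tendsto_finset_range).mono_right
            (pure_le_nhds _)
      rw [← hsum.tsum_eq, ENNReal.ofReal_tsum_of_nonneg (fun i => hindpos _ _) hsum.summable])
  have hν : ∀ s (hs : MeasurableSet s), ν s = ENNReal.ofReal (ℓ (essIndicator m s hs)) :=
    fun s hs => Measure.ofMeasurable_apply s hs
  have : IsFiniteMeasure ν := ⟨by rw [hν _ MeasurableSet.univ]; exact ENNReal.ofReal_lt_top⟩
  have hνm : ν ≪ m := by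
    refine Measure.AbsolutelyContinuous.mk fun s hs h0 => ?_
    rw [hν s hs, hcongr (essIndicator m s hs) 0 (indicator_meas_zero h0), map_zero,
      ENNReal.ofReal_zero]
  have hsimple : ∀ (f : SimpleFunc X ℝ) (hf : MemLp f ∞ m),
      ℓ ⟨f, hf⟩ = ∫ x, f x ∂ν := by
    intro f
    induction f using SimpleFunc.induction with
    | @const k s hs =>
      intro hf
      have e : (⟨_, hf⟩ : essBounded m) = k • essIndicator m _ hs := by
        ext x
        by_cases hx : x ∈ s <;> simp [essIndicator, hx]
      rw [e, map_smul, smul_eq_mul]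
      classical
      rw [SimpleFunc.coe_piecewise, SimpleFunc.coe_const, SimpleFunc.coe_const,
        Function.const_zero, piecewise_eq_indicator]
      rw [integral_indicator hs]
      simp [Measure.real, hν _ hs, ENNReal.toReal_ofReal (hindpos _ hs), mul_comm]
    | add hd h1 h2 =>
      rename_i f g
      intro hf
      have hf' := SimpleFunc.memLp_top f m
      have hg' := SimpleFunc.memLp_top g m
      have e : (⟨_, hf⟩ : essBounded m) = ⟨f, hf'⟩ + ⟨g, hg'⟩ := rfl
      rw [e, map_add, h1 hf', h2 hg', SimpleFunc.coe_add]
      exact (integral_add (SimpleFunc.integrable_of_isFiniteMeasure f)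
        (SimpleFunc.integrable_of_isFiniteMeasure g)).symm
  have hint : ∀ f : essBounded m, ℓ f = ∫ x, f.1 x ∂ν := by
    intro f
    obtain ⟨C, hC0, hC⟩ := f.2.exists_ae_norm_le
    have hae := f.2.1.ae_eq_mk
    set g := f.2.1.mk f.1
    have hg : StronglyMeasurable g := f.2.1.stronglyMeasurable_mk
    have hgC : ∀ᵐ x ∂m, ‖g x‖ ≤ C := by
      filter_upwards [hC, hae] with x hx hx'
      rwa [← hx']
    have hlim := hg.tendsto_approxBounded_ae hgC
    have h1 := hcont C (fun k => ⟨hg.approxBounded C k, SimpleFunc.memLp_top _ m⟩) f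
      (fun k => ae_of_all _ fun x => hg.norm_approxBounded_le hC0 k x)
      (by
        filter_upwards [hlim, hae] with x hx hx'
        rwa [hx'])
    simp_rw [hsimple] at h1
    have h2 : Tendsto (fun k => ∫ x, hg.approxBounded C k x ∂ν) atTop (𝓝 (∫ x, f.1 x ∂ν)) := by
      refine tendsto_integral_of_dominated_convergence (fun _ => C)
        (fun k => (SimpleFunc.aestronglyMeasurable _)) (integrable_const C)
        (fun k => ae_of_all _ fun x => hg.norm_approxBounded_le hC0 k x) ?_
      filter_upwards [hνm.ae_le hlim, hνm.ae_le hae] with x hx hx'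
      rwa [hx']
    exact tendsto_nhds_unique h1 h2
  refine ⟨fun x => (ν.rnDeriv m x).toReal, (Measure.measurable_rnDeriv ν m).ennreal_toReal,
    fun x => ENNReal.toReal_nonneg, Measure.integrable_toReal_rnDeriv, fun f => ?_⟩
  rw [hint f, ← integral_rnDeriv_smul hνm]
  rfl

/-- The dual penalty `γ ∫ exp ((f - c) / γ - 1)`. -/
noncomputable def expPenalty (m : Measure X) (c : X → ℝ) (γ : ℝ) (f : X → ℝ) : ℝ :=
  γ * ∫ x, Real.exp ((f x - c x) / γ - 1) ∂m

variable {m : Measure X} [IsFiniteMeasure m] {c : X → ℝ} {γ : ℝ}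

theorem integrable_exp_penalty (hc : MemLp c ∞ m) {f : X → ℝ} (hf : MemLp f ∞ m) :
    Integrable (fun x => Real.exp ((f x - c x) / γ - 1)) m := by
  have hg : MemLp (fun x => (f x - c x) / γ - 1) ∞ m :=
    ((hf.sub hc).mul_const γ⁻¹).sub (memLp_const 1)
  obtain ⟨C, -, hC⟩ := hg.exists_ae_norm_le
  refine Integrable.of_bound (Real.continuous_exp.comp_aestronglyMeasurable hg.1) (Real.exp C) ?_
  filter_upwards [hC] with x hx
  rw [Real.norm_eq_abs, Real.abs_exp]
  exact Real.exp_le_exp.2 ((le_abs_self _).trans hx)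

theorem convexOn_expPenalty (hγ : 0 < γ) (hc : MemLp c ∞ m) :
    ConvexOn ℝ univ (fun f : essBounded m => expPenalty m c γ f.1) := by
  refine ⟨convex_univ, fun f _ g _ a b ha hb hab => ?_⟩
  change γ * ∫ x, Real.exp ((a * f.1 x + b * g.1 x - c x) / γ - 1) ∂m ≤
    a * (γ * ∫ x, Real.exp ((f.1 x - c x) / γ - 1) ∂m) +
      b * (γ * ∫ x, Real.exp ((g.1 x - c x) / γ - 1) ∂m)
  have hif := (integrable_exp_penalty (γ := γ) hc f.2).const_mul a
  have hig := (integrable_exp_penalty (γ := γ) hc g.2).const_mul b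
  have key : ∫ x, Real.exp ((a * f.1 x + b * g.1 x - c x) / γ - 1) ∂m ≤
      ∫ x, (a * Real.exp ((f.1 x - c x) / γ - 1) + b * Real.exp ((g.1 x - c x) / γ - 1)) ∂m := by
    refine integral_mono (integrable_exp_penalty hc (a • f + b • g).2) (hif.add hig) fun x => ?_
    have h := convexOn_exp.2 (mem_univ ((f.1 x - c x) / γ - 1)) (mem_univ ((g.1 x - c x) / γ - 1))
      ha hb hab
    simp only [smul_eq_mul] at h
    have e : (a * f.1 x + b * g.1 x - c x) / γ - 1 =
        a * ((f.1 x - c x) / γ - 1) + b * ((g.1 x - c x) / γ - 1) := by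
      obtain rfl : b = 1 - a := by linarith
      ring
    simpa only [e] using h
  rw [integral_add hif hig, integral_const_mul, integral_const_mul] at key
  have := mul_le_mul_of_nonneg_left key hγ.le
  linarith

theorem tendsto_expPenalty (hγ : 0 < γ) (hc : MemLp c ∞ m) {C : ℝ} {F : ℕ → essBounded m}
    {f : essBounded m} (hC : ∀ k, ∀ᵐ x ∂m, ‖(F k).1 x‖ ≤ C)
    (hlim : ∀ᵐ x ∂m, Tendsto (fun k => (F k).1 x) atTop (𝓝 (f.1 x))) :
    Tendsto (fun k => expPenalty m c γ (F k).1) atTop (𝓝 (expPenalty m c γ f.1)) := by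
  refine Tendsto.const_mul γ (tendsto_integral_of_dominated_convergence
    (fun x => Real.exp ((C - c x) / γ - 1))
    (fun k => (integrable_exp_penalty hc (F k).2).1)
    (integrable_exp_penalty hc (memLp_const C)) (fun k => ?_) ?_)
  · filter_upwards [hC k] with x hx
    rw [Real.norm_eq_abs, Real.abs_exp]
    have := (le_abs_self _).trans hx
    gcongr
  · filter_upwards [hlim] with x hx
    exact (Real.continuous_exp.tendsto _).comp (((hx.sub_const _).div_const _).sub_const _)

theorem nonneg_of_le_expPenalty (hγ : 0 < γ) (hc : MemLp c ∞ m) (ℓ : essBounded m →ₗ[ℝ] ℝ) {S : ℝ}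
    (h : ∀ f : essBounded m, ℓ f ≤ expPenalty m c γ f.1 + S) (f : essBounded m)
    (hf : ∀ x, 0 ≤ f.1 x) : 0 ≤ ℓ f := by
  by_contra! hneg
  set M := expPenalty m c γ 0 + S
  have hM0 : 0 ≤ M := by simpa using h 0
  have hmono : ∀ t : ℝ, 0 ≤ t → expPenalty m c γ ((-t) • f : essBounded m).1 ≤
      expPenalty m c γ 0 := by
    intro t ht
    refine mul_le_mul_of_nonneg_left (integral_mono (integrable_exp_penalty hc ((-t) • f).2)
      (integrable_exp_penalty hc MemLp.zero) fun x => ?_) hγ.le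
    have : -t * f.1 x ≤ 0 := by nlinarith [hf x]
    change Real.exp ((-t * f.1 x - c x) / γ - 1) ≤ Real.exp ((0 - c x) / γ - 1)
    gcongr
  have ht : 0 ≤ (M + 1) / (-ℓ f) := by
    have : 0 < -ℓ f := by linarith
    positivity
  have h1 := (h ((-((M + 1) / (-ℓ f))) • f)).trans (add_le_add_left (hmono _ ht) S)
  rw [map_smul, smul_eq_mul] at h1
  have : -((M + 1) / (-ℓ f)) * ℓ f = M + 1 := by
    have := hneg.ne
    field_simp
  linarith

theorem tendsto_of_le_expPenalty (hγ : 0 < γ) (hc : MemLp c ∞ m) (ℓ : essBounded m →ₗ[ℝ] ℝ)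
    {S : ℝ} (h : ∀ f : essBounded m, ℓ f ≤ expPenalty m c γ f.1 + S) (C : ℝ)
    (F : ℕ → essBounded m) (f : essBounded m) (hC : ∀ k, ∀ᵐ x ∂m, ‖(F k).1 x‖ ≤ C)
    (hlim : ∀ᵐ x ∂m, Tendsto (fun k => (F k).1 x) atTop (𝓝 (f.1 x))) :
    Tendsto (fun k => ℓ (F k)) atTop (𝓝 (ℓ f)) := by
  obtain ⟨D, hD0, hD⟩ := f.2.exists_ae_norm_le
  set M := expPenalty m c γ 0 + S
  have hM0 : 0 ≤ M := by simpa using h 0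
  have hsmall : ∀ t : ℝ, ∀ᶠ k in atTop, t * ℓ (F k - f) < M + 1 := by
    intro t
    have hF := tendsto_expPenalty hγ hc (C := |t| * (C + D)) (F := fun k => t • (F k - f)) (f := 0)
      (fun k => by
        filter_upwards [hC k, hD] with x h1 h2
        change ‖t * ((F k).1 x - f.1 x)‖ ≤ _
        rw [norm_mul, Real.norm_eq_abs]
        gcongr
        exact (norm_sub_le _ _).trans (add_le_add h1 h2))
      (by
        filter_upwards [hlim] with x hx
        have := (hx.sub_const (f.1 x)).const_mul t
        simpa using this)
    filter_upwards [(hF.add_const S).eventually (gt_mem_nhds (lt_add_one _))] with k hk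
    have := h (t • (F k - f))
    rw [map_smul, smul_eq_mul] at this
    exact this.trans_lt hk
  rw [Metric.tendsto_atTop']
  intro ε hε
  obtain ⟨N, hN⟩ := eventually_atTop.1 ((hsmall ((M + 1) / ε)).and (hsmall (-((M + 1) / ε))))
  refine ⟨N, fun k hk => ?_⟩
  obtain ⟨h1, h2⟩ := hN k hk.le
  rw [Real.dist_eq, ← map_sub, abs_lt]
  have hpos : 0 < (M + 1) / ε := by positivity
  have he : (M + 1) / ε * ε = M + 1 := by field_simp
  constructor
  · by_contra! hcon
    nlinarith
  · by_contra! hcon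
    nlinarith

theorem neg_one_le_mul_log {t u : ℝ} (ht : 0 ≤ t) (hu : 0 < u) (h : t ≤ u ∨ 1 ≤ u) :
    -1 ≤ t * Real.log u := by
  rcases le_total 1 u with h1 | h1
  · have := mul_nonneg ht (Real.log_nonneg h1)
    linarith
  · have htu : t ≤ u ∨ u = 1 := h.imp_right h1.antisymm
    rcases htu with htu | rfl
    swap
    · simp
    have h3 := Real.one_sub_inv_le_log_of_pos hu
    have h4 := Real.log_nonpos hu.le h1
    have h5 : u * (1 - u⁻¹) = u - 1 := by field_simp
    nlinarith [mul_le_mul_of_nonneg_left h3 hu.le]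

/-- If the pairing with `p` minus the exponential penalty is bounded, so is the entropy of `p`. -/
theorem entropy_le_of_le_expPenalty (hγ : 0 < γ) (hc : MemLp c ∞ m) {p : X → ℝ}
    (hp : Measurable p) (hp0 : ∀ x, 0 ≤ p x) (hpi : Integrable p m) {S : ℝ}
    (h : ∀ f : X → ℝ, MemLp f ∞ m → ∫ x, p x * f x ∂m ≤ expPenalty m c γ f + S) :
    Integrable (fun x => p x * Real.log (p x)) m ∧
      ∫ x, c x * p x ∂m + γ * ∫ x, p x * Real.log (p x) ∂m ≤ S := by
  let q : ℕ → X → ℝ := fun k x => max (k + 1 : ℝ)⁻¹ (min (k + 1) (p x))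
  have hk0 : ∀ k : ℕ, (0 : ℝ) < (k + 1 : ℝ)⁻¹ := fun k => by positivity
  have hq0 : ∀ k x, 0 < q k x := fun k x => lt_max_of_lt_left (hk0 k)
  have hqm : ∀ k, Measurable (q k) := fun k => measurable_const.max (measurable_const.min hp)
  have hqlt : ∀ k x, q k x ≤ k + 1 := fun k x => by
    have : (k + 1 : ℝ)⁻¹ ≤ 1 := inv_le_one_of_one_le₀ (by simp)
    exact max_le (this.trans (by simp)) (min_le_left _ _)
  have hqle : ∀ k x, q k x ≤ p x + 1 := fun k x => by
    have : (k + 1 : ℝ)⁻¹ ≤ 1 := inv_le_one_of_one_le₀ (by simp)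
    exact max_le (by linarith [hp0 x]) ((min_le_right _ _).trans (by linarith))
  have hqlim : ∀ x, Tendsto (fun k => q k x) atTop (𝓝 (p x)) := by
    intro x
    have h1 : Tendsto (fun k : ℕ => (k + 1 : ℝ)⁻¹) atTop (𝓝 0) := by
      simpa using tendsto_one_div_add_atTop_nhds_zero_nat (𝕜 := ℝ)
    have h2 : Tendsto (fun k : ℕ => min (k + 1 : ℝ) (p x)) atTop (𝓝 (p x)) := by
      refine tendsto_const_nhds.congr' ?_
      filter_upwards [eventually_ge_atTop ⌈p x⌉₊] with k hk
      have := Nat.ceil_le.1 hk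
      exact (min_eq_right (by linarith)).symm
    simpa [max_eq_right (hp0 x)] using h1.max h2
  have hlogm : ∀ k, MemLp (fun x => Real.log (q k x)) ∞ m := fun k => by
    refine memLp_top_of_bound ((hqm k).log.aestronglyMeasurable) (Real.log (k + 1))
      (ae_of_all _ fun x => ?_)
    rw [Real.norm_eq_abs, abs_le]
    constructor
    · rw [← Real.log_inv]
      exact Real.log_le_log (hk0 k) (le_max_left _ _)
    · exact Real.log_le_log (hq0 k x) (hqlt k x)
  have hpf : ∀ {f : X → ℝ}, MemLp f ∞ m → Integrable (fun x => p x * f x) m := fun hf =>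
    hpi.mul_of_top_left hf
  have hpc := hpf hc
  set R : ℕ → ℝ := fun k => γ⁻¹ * (S - ∫ x, p x * c x ∂m) - ∫ x, p x ∂m + ∫ x, q k x ∂m +
    ∫ _, (1 : ℝ) ∂m with hR
  have hRlim : Tendsto R atTop (𝓝 (γ⁻¹ * (S - ∫ x, p x * c x ∂m) + ∫ _, (1 : ℝ) ∂m)) := by
    have h1 : Tendsto (fun k => ∫ x, q k x ∂m) atTop (𝓝 (∫ x, p x ∂m)) :=
      tendsto_integral_of_dominated_convergence (fun x => p x + 1)
        (fun k => (hqm k).aestronglyMeasurable) (hpi.add (integrable_const 1))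
        (fun k => ae_of_all _ fun x => by
          rw [Real.norm_of_nonneg (hq0 k x).le]
          exact hqle k x) (ae_of_all _ hqlim)
    have := (h1.const_add (γ⁻¹ * (S - ∫ x, p x * c x ∂m) - ∫ x, p x ∂m)).add_const
      (∫ _, (1 : ℝ) ∂m)
    simpa [hR] using this
  have hgi : ∀ k, Integrable (fun x => p x * Real.log (q k x) + 1) m := fun k =>
    (hpf (hlogm k)).add (integrable_const 1)
  have hgR : ∀ k, ∫ x, (p x * Real.log (q k x) + 1) ∂m ≤ R k := by
    intro k
    have hk := h (fun x => c x + γ * (Real.log (q k x) + 1))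
      (hc.add (((hlogm k).add (memLp_const 1)).const_mul γ))
    have e1 : expPenalty m c γ (fun x => c x + γ * (Real.log (q k x) + 1)) =
        γ * ∫ x, q k x ∂m := by
      unfold expPenalty
      congr 1
      refine integral_congr_ae (ae_of_all _ fun x => ?_)
      have : (c x + γ * (Real.log (q k x) + 1) - c x) / γ - 1 = Real.log (q k x) := by
        field_simp
        ring
      simp only [this, Real.exp_log (hq0 k x)]
    have hsum : Integrable (fun x => γ * (p x * Real.log (q k x)) + γ * p x) m :=
      ((hpf (hlogm k)).const_mul γ).add (hpi.const_mul γ)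
    have e2 : ∫ x, p x * (c x + γ * (Real.log (q k x) + 1)) ∂m = ∫ x, p x * c x ∂m +
        (γ * ∫ x, p x * Real.log (q k x) ∂m + γ * ∫ x, p x ∂m) := by
      rw [← integral_const_mul, ← integral_const_mul,
        ← integral_add ((hpf (hlogm k)).const_mul γ) (hpi.const_mul γ), ← integral_add hpc hsum]
      congr 1
      ext x
      ring
    rw [e1, e2] at hk
    rw [integral_add (hpf (hlogm k)) (integrable_const 1)]
    have h3 : ∫ x, p x * Real.log (q k x) ∂m = γ⁻¹ * (γ * ∫ x, p x * Real.log (q k x) ∂m) := by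
      field_simp
    have h4 : γ * ∫ x, p x * Real.log (q k x) ∂m ≤
        S - ∫ x, p x * c x ∂m - γ * ∫ x, p x ∂m + γ * ∫ x, q k x ∂m := by linarith
    have h5 := mul_le_mul_of_nonneg_left h4 (inv_pos.2 hγ).le
    have h6 : γ⁻¹ * (S - ∫ x, p x * c x ∂m - γ * ∫ x, p x ∂m + γ * ∫ x, q k x ∂m) =
        γ⁻¹ * (S - ∫ x, p x * c x ∂m) - ∫ x, p x ∂m + ∫ x, q k x ∂m := by
      field_simp
    simp only [hR]
    linarith
  have hg0 : ∀ k x, 0 ≤ p x * Real.log (q k x) + 1 := by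
    intro k x
    have := neg_one_le_mul_log (hp0 x) (hq0 k x) (by
      rcases le_total (p x) (k + 1) with hx | hx
      · left
        exact le_max_of_le_right (le_min hx le_rfl)
      · right
        exact le_max_of_le_right (le_min (by simp) ((by simp : (1 : ℝ) ≤ k + 1).trans hx)))
    linarith
  have hG0 : ∀ x, 0 ≤ p x * Real.log (p x) + 1 := by
    intro x
    rcases (hp0 x).eq_or_lt with h0 | h0
    · simp [← h0]
    · linarith [neg_one_le_mul_log h0.le h0 (Or.inl le_rfl)]
  have hGm : Measurable fun x => p x * Real.log (p x) + 1 := (hp.mul hp.log).add_const 1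
  have hglim : ∀ x, Tendsto (fun k => p x * Real.log (q k x) + 1) atTop
      (𝓝 (p x * Real.log (p x) + 1)) := by
    intro x
    rcases (hp0 x).eq_or_lt with h0 | h0
    · simp [← h0]
    · exact (((hqlim x).log h0.ne').const_mul _).add_const _
  have hfatou : ∫⁻ x, ENNReal.ofReal (p x * Real.log (p x) + 1) ∂m ≤
      ENNReal.ofReal (γ⁻¹ * (S - ∫ x, p x * c x ∂m) + ∫ _, (1 : ℝ) ∂m) := by
    calc ∫⁻ x, ENNReal.ofReal (p x * Real.log (p x) + 1) ∂m
        = ∫⁻ x, liminf (fun k => ENNReal.ofReal (p x * Real.log (q k x) + 1)) atTop ∂m := by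
          refine lintegral_congr fun x => ?_
          exact ((ENNReal.continuous_ofReal.tendsto _).comp (hglim x)).liminf_eq.symm
      _ ≤ liminf (fun k => ∫⁻ x, ENNReal.ofReal (p x * Real.log (q k x) + 1) ∂m) atTop :=
          lintegral_liminf_le fun k => ((hp.mul (hqm k).log).add_const 1).ennreal_ofReal
      _ ≤ liminf (fun k => ENNReal.ofReal (R k)) atTop := by
          refine liminf_le_liminf (Eventually.of_forall fun k => ?_)
          rw [← ofReal_integral_eq_lintegral_ofReal (hgi k) (ae_of_all _ (hg0 k))]
          exact ENNReal.ofReal_le_ofReal (hgR k)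
      _ = _ := ((ENNReal.continuous_ofReal.tendsto _).comp hRlim).liminf_eq
  have hGi : Integrable (fun x => p x * Real.log (p x) + 1) m :=
    ⟨hGm.aestronglyMeasurable, by
      rw [hasFiniteIntegral_iff_ofReal (ae_of_all _ hG0)]
      exact hfatou.trans_lt ENNReal.ofReal_lt_top⟩
  have hi : Integrable (fun x => p x * Real.log (p x)) m := by
    refine (hGi.sub (integrable_const (1 : ℝ))).congr (ae_of_all _ fun x => ?_)
    simp
  refine ⟨hi, ?_⟩
  have hR0 : 0 ≤ γ⁻¹ * (S - ∫ x, p x * c x ∂m) + ∫ _, (1 : ℝ) ∂m :=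
    ge_of_tendsto' hRlim fun k => (integral_nonneg (hg0 k)).trans (hgR k)
  rw [← ofReal_integral_eq_lintegral_ofReal hGi (ae_of_all _ hG0),
    ENNReal.ofReal_le_ofReal_iff hR0, integral_add hi (integrable_const 1)] at hfatou
  have h7 := mul_le_mul_of_nonneg_left (le_of_add_le_add_right hfatou) hγ.le
  rw [mul_inv_cancel_left₀ hγ.ne'] at h7
  simp_rw [mul_comm (c _)]
  linarith

/-- A linear constraint dominated by the exponential penalty is met by a nonnegative density whose
regularized cost obeys the same bound. -/
theorem exists_density_of_le_expPenalty {A : Type*} [AddCommGroup A] [Module ℝ A] (hγ : 0 < γ)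
    (hc : MemLp c ∞ m) (T : A →ₗ[ℝ] essBounded m) (L : A →ₗ[ℝ] ℝ) {S : ℝ}
    (h : ∀ a, L a ≤ expPenalty m c γ (T a).1 + S) :
    ∃ p : X → ℝ, Measurable p ∧ (∀ x, 0 ≤ p x) ∧ Integrable p m ∧
      (∀ a, ∫ x, p x * (T a).1 x ∂m = L a) ∧
      Integrable (fun x => p x * Real.log (p x)) m ∧
      ∫ x, c x * p x ∂m + γ * ∫ x, p x * Real.log (p x) ∂m ≤ S := by
  obtain ⟨ℓ, hT, hℓ⟩ := exists_linearMap_comp_eq_le_convex T L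
    (fun f : essBounded m => expPenalty m c γ f.1 + S)
    ((convexOn_expPenalty hγ hc).add (convexOn_const S convex_univ)) h
  obtain ⟨p, hp, hp0, hpi, hpℓ⟩ := exists_density_of_positive_of_continuous ℓ
    (nonneg_of_le_expPenalty hγ hc ℓ hℓ) (tendsto_of_le_expPenalty hγ hc ℓ hℓ)
  refine ⟨p, hp, hp0, hpi, fun a => by rw [← hpℓ, hT], ?_⟩
  exact entropy_le_of_le_expPenalty hγ hc hp hp0 hpi fun f hf => by
    rw [← hpℓ ⟨f, hf⟩]
    exact hℓ _

end Density

end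

section Duality

variable {X : Type*} [MeasurableSpace X]

theorem mul_le_mul_log_add_exp {t : ℝ} (ht : 0 ≤ t) (s : ℝ) :
    t * s ≤ t * Real.log t + Real.exp (s - 1) := by
  rcases ht.eq_or_lt with rfl | h0
  · simp [Real.exp_nonneg]
  · have h1 := Real.add_one_le_exp (s - 1 - Real.log t)
    have h2 := mul_le_mul_of_nonneg_left h1 ht
    have h3 : t * Real.exp (s - 1 - Real.log t) = Real.exp (s - 1) := by
      rw [Real.exp_sub, Real.exp_log h0]
      field_simp
    linarith

theorem integral_sub_expPenalty_le {m : Measure X} [IsFiniteMeasure m] {c : X → ℝ} {γ : ℝ}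
    (hγ : 0 < γ) (hc : MemLp c ∞ m) {p : X → ℝ} (hp0 : ∀ x, 0 ≤ p x) (hpi : Integrable p m)
    (hent : Integrable (fun x => p x * Real.log (p x)) m) {f : X → ℝ} (hf : MemLp f ∞ m) :
    ∫ x, p x * f x ∂m - expPenalty m c γ f ≤
      ∫ x, c x * p x ∂m + γ * ∫ x, p x * Real.log (p x) ∂m := by
  have h1 : Integrable (fun x => p x * f x) m := hpi.mul_of_top_left hf
  have h2 : Integrable (fun x => c x * p x) m := hpi.mul_of_top_right hc
  have h3 := hent.const_mul γ
  have h4 := (integrable_exp_penalty (γ := γ) hc hf).const_mul γ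
  have key : ∫ x, p x * f x ∂m ≤ ∫ x, ((c x * p x + γ * (p x * Real.log (p x))) +
      γ * Real.exp ((f x - c x) / γ - 1)) ∂m := by
    refine integral_mono h1 ((h2.add h3).add h4) fun x => ?_
    have h := mul_le_mul_of_nonneg_left
      (mul_le_mul_log_add_exp (hp0 x) ((f x - c x) / γ)) hγ.le
    have e : γ * (p x * ((f x - c x) / γ)) = p x * f x - c x * p x := by
      field_simp
    simp only
    linarith
  have h5 : Integrable (fun x => c x * p x + γ * (p x * Real.log (p x))) m := h2.add h3
  rw [integral_add h5 h4, integral_add h2 h3, integral_const_mul, integral_const_mul] at key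
  unfold expPenalty
  linarith

theorem lintegral_neg_mul_log_ne_top {m : Measure X} [IsFiniteMeasure m] {p : X → ℝ}
    (hp0 : ∀ x, 0 ≤ p x) : ∫⁻ x, ENNReal.ofReal (-(p x * Real.log (p x))) ∂m ≠ ∞ := by
  have h : ∫⁻ x, ENNReal.ofReal (-(p x * Real.log (p x))) ∂m ≤ ∫⁻ _, 1 ∂m := by
    refine lintegral_mono fun x => ?_
    rw [← ENNReal.ofReal_one]
    refine ENNReal.ofReal_le_ofReal ?_
    rcases (hp0 x).eq_or_lt with h0 | h0
    · simp [← h0]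
    · linarith [neg_one_le_mul_log h0.le h0 (Or.inl le_rfl)]
  refine (h.trans_lt ?_).ne
  simp

theorem integrable_mul_log_of_lintegral_ne_top {m : Measure X} [IsFiniteMeasure m] {p : X → ℝ}
    (hp : Measurable p) (hp0 : ∀ x, 0 ≤ p x)
    (h : ∫⁻ x, ENNReal.ofReal (p x * Real.log (p x)) ∂m ≠ ∞) :
    Integrable (fun x => p x * Real.log (p x)) m := by
  have hm : Measurable fun x => p x * Real.log (p x) := hp.mul hp.log
  refine ⟨hm.aestronglyMeasurable, ?_⟩
  rw [hasFiniteIntegral_iff_norm]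
  have e : ∀ y : ℝ, ENNReal.ofReal ‖y‖ = ENNReal.ofReal y + ENNReal.ofReal (-y) := by
    intro y
    rcases le_total 0 y with hy | hy
    · simp [abs_of_nonneg hy, ENNReal.ofReal_of_nonpos (neg_nonpos.2 hy)]
    · simp [abs_of_nonpos hy, ENNReal.ofReal_of_nonpos hy]
  simp_rw [e]
  rw [lintegral_add_left hm.ennreal_ofReal]
  exact ENNReal.add_lt_top.2 ⟨h.lt_top, (lintegral_neg_mul_log_ne_top hp0).lt_top⟩

theorem integral_map_withDensity_ofReal_s5 {Y : Type*} [MeasurableSpace Y] {m : Measure X}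
    {p : X → ℝ} (hp : Measurable p) (hp0 : ∀ x, 0 ≤ p x) {g : X → Y} (hg : Measurable g)
    {f : Y → ℝ}
    (hf : AEStronglyMeasurable f ((m.withDensity fun x => ENNReal.ofReal (p x)).map g)) :
    ∫ y, f y ∂((m.withDensity fun x => ENNReal.ofReal (p x)).map g) =
      ∫ x, p x * f (g x) ∂m := by
  rw [integral_map hg.aemeasurable hf,
    integral_withDensity_eq_integral_toReal_smul hp.ennreal_ofReal
      (ae_of_all _ fun _ => ENNReal.ofReal_lt_top)]
  simp [ENNReal.toReal_ofReal, hp0]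

theorem setIntegral_eq_integral_of_map_withDensity {Y : Type*} [TopologicalSpace Y]
    [MeasurableSpace Y] [BorelSpace Y] [SecondCountableTopology Y] {m : Measure X}
    {p : X → ℝ} (hp : Measurable p) (hp0 : ∀ x, 0 ≤ p x) {g : X → Y} (hg : Measurable g)
    {μ : Measure Y} (hμ : (m.withDensity fun x => ENNReal.ofReal (p x)).map g = μ) {K : Set Y}
    (hK : MeasurableSet K) (hμK : μ Kᶜ = 0) {f : Y → ℝ} (hf : ContinuousOn f K) :
    ∫ y in K, f y ∂μ = ∫ x, p x * f (g x) ∂m := by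
  have hr : μ.restrict K = μ := Measure.restrict_eq_self_of_ae_mem (mem_ae_iff.2 hμK)
  have hfm : AEStronglyMeasurable f μ := hr ▸ hf.aestronglyMeasurable hK
  rw [hr]
  subst hμ
  exact integral_map_withDensity_ofReal_s5 hp hp0 hg hfm

theorem ContinuousOn.memLp_top_restrict {Y : Type*} [TopologicalSpace Y] [T2Space Y]
    [MeasurableSpace Y] [BorelSpace Y] [SecondCountableTopology Y] {m : Measure Y} {K : Set Y}
    (hK : IsCompact K) {f : Y → ℝ} (hf : ContinuousOn f K) : MemLp f ∞ (m.restrict K) := by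
  obtain ⟨C, hC⟩ := hK.exists_bound_of_continuousOn hf
  exact memLp_top_of_bound (hf.aestronglyMeasurable hK.measurableSet) C
    (ae_restrict_of_forall_mem hK.measurableSet hC)

/-- The functions that are continuous on a set, as a space of globally defined functions. -/
def continuousOnSubmodule {Y : Type*} [TopologicalSpace Y] (K : Set Y) : Submodule ℝ (Y → ℝ) where
  carrier := {f | ContinuousOn f K}
  add_mem' hf hg := ContinuousOn.add hf hg
  zero_mem' := continuousOn_const
  smul_mem' k _ hf := ContinuousOn.const_smul hf k

end Duality

section Plans

variable {n : ℕ} {Ω₁ Ω₂ : Set (Fin n → ℝ)} {μ₁ μ₂ : Measure (Fin n → ℝ)}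
  {c : (Fin n → ℝ) × (Fin n → ℝ) → ℝ} {γ : ℝ} {π : (Fin n → ℝ) × (Fin n → ℝ) → ℝ}

theorem memLp_top_add_potentials (hΩ₁ : IsCompact Ω₁) (hΩ₂ : IsCompact Ω₂)
    {α₁ α₂ : (Fin n → ℝ) → ℝ} (h₁ : ContinuousOn α₁ Ω₁) (h₂ : ContinuousOn α₂ Ω₂) :
    MemLp (fun x : (Fin n → ℝ) × (Fin n → ℝ) => α₁ x.1 + α₂ x.2) ∞
      (volume.restrict (Ω₁ ×ˢ Ω₂)) :=
  ContinuousOn.memLp_top_restrict (hΩ₁.prod hΩ₂)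
    ((h₁.comp continuousOn_fst fun _ hx => hx.1).add (h₂.comp continuousOn_snd fun _ hx => hx.2))

theorem isFiniteMeasure_restrict_prod (hΩ₁ : IsCompact Ω₁) (hΩ₂ : IsCompact Ω₂) :
    IsFiniteMeasure (volume.restrict (Ω₁ ×ˢ Ω₂)) :=
  ⟨by simpa using (hΩ₁.prod hΩ₂).measure_lt_top⟩

theorem primalValueEnt_eq_coe
    (h : Integrable (fun x => π x * Real.log (π x)) (volume.restrict (Ω₁ ×ˢ Ω₂))) :
    primalValueEnt Ω₁ Ω₂ c γ π = (((∫ x in Ω₁ ×ˢ Ω₂, c x * π x) +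
      γ * ∫ x in Ω₁ ×ˢ Ω₂, π x * Real.log (π x) : ℝ) : EReal) := by
  have h1 := h.lintegral_lt_top.ne
  have h2 := h.neg.lintegral_lt_top.ne
  simp only [Pi.neg_apply] at h2
  rw [primalValueEnt, integral_eq_lintegral_pos_part_sub_lintegral_neg_part h,
    ← EReal.coe_ennreal_toReal h1, ← EReal.coe_ennreal_toReal h2]
  norm_cast

theorem primalValueEnt_eq_top (hΩ₁ : IsCompact Ω₁) (hΩ₂ : IsCompact Ω₂) (hγ : 0 < γ)
    (hπ : ∀ x, 0 ≤ π x)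
    (h : ∫⁻ x in Ω₁ ×ˢ Ω₂, ENNReal.ofReal (π x * Real.log (π x)) = ∞) :
    primalValueEnt Ω₁ Ω₂ c γ π = ⊤ := by
  have := isFiniteMeasure_restrict_prod hΩ₁ hΩ₂
  rw [primalValueEnt, h, ← EReal.coe_ennreal_toReal (lintegral_neg_mul_log_ne_top hπ),
    EReal.coe_ennreal_top, EReal.top_sub_coe, EReal.coe_mul_top_of_pos hγ, EReal.coe_add_top]

theorem IsFeasiblePlan.dualValueEnt_le_primalValueEnt [IsFiniteMeasure μ₁] (hΩ₁ : IsCompact Ω₁)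
    (hΩ₂ : IsCompact Ω₂) (hμ₁ : μ₁ Ω₁ᶜ = 0) (hμ₂ : μ₂ Ω₂ᶜ = 0)
    (hc : ContinuousOn c (Ω₁ ×ˢ Ω₂)) (hγ : 0 < γ) (hπ : IsFeasiblePlan Ω₁ Ω₂ μ₁ μ₂ π)
    {α₁ α₂ : (Fin n → ℝ) → ℝ} (h₁ : ContinuousOn α₁ Ω₁) (h₂ : ContinuousOn α₂ Ω₂) :
    ((dualValueEnt Ω₁ Ω₂ μ₁ μ₂ c γ α₁ α₂ : ℝ) : EReal) ≤ primalValueEnt Ω₁ Ω₂ c γ π := by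
  obtain ⟨hm, h0, hfst, hsnd⟩ := hπ
  have := isFiniteMeasure_restrict_prod hΩ₁ hΩ₂
  by_cases htop : ∫⁻ x in Ω₁ ×ˢ Ω₂, ENNReal.ofReal (π x * Real.log (π x)) = ∞
  · rw [primalValueEnt_eq_top hΩ₁ hΩ₂ hγ h0 htop]
    exact le_top
  have hent := integrable_mul_log_of_lintegral_ne_top hm h0 htop
  rw [primalValueEnt_eq_coe hent, EReal.coe_le_coe_iff]
  have hint : Integrable π (volume.restrict (Ω₁ ×ˢ Ω₂)) := by
    refine ⟨hm.aestronglyMeasurable, ?_⟩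
    rw [hasFiniteIntegral_iff_ofReal (ae_of_all _ h0)]
    have : μ₁ univ = ∫⁻ x in Ω₁ ×ˢ Ω₂, ENNReal.ofReal (π x) := by
      rw [← hfst, Measure.map_apply measurable_fst MeasurableSet.univ, preimage_univ,
        withDensity_apply _ MeasurableSet.univ, Measure.restrict_univ]
    rw [← this]
    exact measure_lt_top _ _
  have hm1 : MemLp (fun x : (Fin n → ℝ) × (Fin n → ℝ) => α₁ x.1) ∞
      (volume.restrict (Ω₁ ×ˢ Ω₂)) := by
    simpa using memLp_top_add_potentials hΩ₁ hΩ₂ h₁ (continuousOn_const (c := (0 : ℝ)))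
  have hm2 : MemLp (fun x : (Fin n → ℝ) × (Fin n → ℝ) => α₂ x.2) ∞
      (volume.restrict (Ω₁ ×ˢ Ω₂)) := by
    simpa using memLp_top_add_potentials hΩ₁ hΩ₂ (continuousOn_const (c := (0 : ℝ))) h₂
  have key := integral_sub_expPenalty_le hγ
    (ContinuousOn.memLp_top_restrict (hΩ₁.prod hΩ₂) hc) h0 hint hent (hm1.add hm2)
  have hadd : ∫ x in Ω₁ ×ˢ Ω₂, π x * (α₁ x.1 + α₂ x.2) =
      ∫ x in Ω₁, α₁ x ∂μ₁ + ∫ x in Ω₂, α₂ x ∂μ₂ := by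
    rw [setIntegral_eq_integral_of_map_withDensity hm h0 measurable_fst hfst
        hΩ₁.measurableSet hμ₁ h₁, setIntegral_eq_integral_of_map_withDensity hm h0 measurable_snd
        hsnd hΩ₂.measurableSet hμ₂ h₂]
    simp_rw [mul_add]
    exact integral_add (hint.mul_of_top_left hm1) (hint.mul_of_top_left hm2)
  rw [dualValueEnt, ← hadd]
  exact key

theorem exists_isFeasiblePlan_primalValueEnt_le [IsFiniteMeasure μ₁] [IsFiniteMeasure μ₂]
    (hΩ₁ : IsCompact Ω₁) (hΩ₂ : IsCompact Ω₂) (hμ₁ : μ₁ Ω₁ᶜ = 0) (hμ₂ : μ₂ Ω₂ᶜ = 0)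
    (hc : ContinuousOn c (Ω₁ ×ˢ Ω₂)) (hγ : 0 < γ) {S : ℝ}
    (hS : ∀ α₁ α₂ : (Fin n → ℝ) → ℝ, ContinuousOn α₁ Ω₁ → ContinuousOn α₂ Ω₂ →
      dualValueEnt Ω₁ Ω₂ μ₁ μ₂ c γ α₁ α₂ ≤ S) :
    ∃ π, IsFeasiblePlan Ω₁ Ω₂ μ₁ μ₂ π ∧ primalValueEnt Ω₁ Ω₂ c γ π ≤ S := by
  have := isFiniteMeasure_restrict_prod hΩ₁ hΩ₂
  let T : (continuousOnSubmodule Ω₁ × continuousOnSubmodule Ω₂) →ₗ[ℝ]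
      essBounded (volume.restrict (Ω₁ ×ˢ Ω₂)) :=
    { toFun := fun a => ⟨fun x => a.1.1 x.1 + a.2.1 x.2,
        memLp_top_add_potentials hΩ₁ hΩ₂ a.1.2 a.2.2⟩
      map_add' := fun a b => by
        ext x
        simp
        ring
      map_smul' := fun k a => by
        ext x
        simp
        ring }
  have hi₁ : ∀ a : continuousOnSubmodule Ω₁, IntegrableOn a.1 Ω₁ μ₁ := fun a =>
    ContinuousOn.integrableOn_compact hΩ₁ a.2
  have hi₂ : ∀ a : continuousOnSubmodule Ω₂, IntegrableOn a.1 Ω₂ μ₂ := fun a =>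
    ContinuousOn.integrableOn_compact hΩ₂ a.2
  let L : (continuousOnSubmodule Ω₁ × continuousOnSubmodule Ω₂) →ₗ[ℝ] ℝ :=
    { toFun := fun a => ∫ x in Ω₁, a.1.1 x ∂μ₁ + ∫ x in Ω₂, a.2.1 x ∂μ₂
      map_add' := fun a b => by
        simp only [Prod.fst_add, Prod.snd_add, Submodule.coe_add, Pi.add_apply]
        rw [integral_add (hi₁ a.1) (hi₁ b.1), integral_add (hi₂ a.2) (hi₂ b.2)]
        ring
      map_smul' := fun k a => by
        simp only [Prod.smul_fst, Prod.smul_snd, Submodule.coe_smul, Pi.smul_apply, smul_eq_mul,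
          integral_const_mul, RingHom.id_apply]
        ring }
  obtain ⟨p, hp, hp0, hpi, hpL, hent, hle⟩ := exists_density_of_le_expPenalty hγ
    (ContinuousOn.memLp_top_restrict (hΩ₁.prod hΩ₂) hc) T L (S := S) fun a => by
      have := hS a.1.1 a.2.1 a.1.2 a.2.2
      rw [dualValueEnt] at this
      change ∫ x in Ω₁, a.1.1 x ∂μ₁ + ∫ x in Ω₂, a.2.1 x ∂μ₂ ≤
        γ * (∫ x in Ω₁ ×ˢ Ω₂, Real.exp ((a.1.1 x.1 + a.2.1 x.2 - c x) / γ - 1)) + S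
      linarith
  have hfin := isFiniteMeasure_withDensity_ofReal hpi.2
  have hr₁ : μ₁.restrict Ω₁ = μ₁ := Measure.restrict_eq_self_of_ae_mem (mem_ae_iff.2 hμ₁)
  have hr₂ : μ₂.restrict Ω₂ = μ₂ := Measure.restrict_eq_self_of_ae_mem (mem_ae_iff.2 hμ₂)
  refine ⟨p, ⟨hp, hp0, ?_, ?_⟩, ?_⟩
  · refine ext_of_forall_integral_eq_of_IsFiniteMeasure fun f => ?_
    rw [integral_map_withDensity_ofReal_s5 hp hp0 measurable_fst
      f.continuous.aestronglyMeasurable]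
    simpa [T, L, hr₁] using hpL (⟨f, f.continuous.continuousOn⟩, 0)
  · refine ext_of_forall_integral_eq_of_IsFiniteMeasure fun f => ?_
    rw [integral_map_withDensity_ofReal_s5 hp hp0 measurable_snd
      f.continuous.aestronglyMeasurable]
    simpa [T, L, hr₂] using hpL (0, ⟨f, f.continuous.continuousOn⟩)
  · rw [primalValueEnt_eq_coe hent]
    exact_mod_cast hle

end Plans

/-- Strong duality for entropically regularized optimal transport, and attainment of the
infimum when the supremum is finite. -/
theorem strong_duality_entropic {n : ℕ}
    (Ω₁ Ω₂ : Set (Fin n → ℝ)) (hΩ₁ : IsCompact Ω₁) (hΩ₂ : IsCompact Ω₂)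
    (μ₁ μ₂ : Measure (Fin n → ℝ)) [IsFiniteMeasure μ₁] [IsFiniteMeasure μ₂]
    (hμ₁ : μ₁ Ω₁ᶜ = 0) (hμ₂ : μ₂ Ω₂ᶜ = 0) (hmass : μ₁ Ω₁ = μ₂ Ω₂)
    (c : (Fin n → ℝ) × (Fin n → ℝ) → ℝ) (hc : ContinuousOn c (Ω₁ ×ˢ Ω₂))
    (γ : ℝ) (hγ : 0 < γ) :
    sInf {v : EReal | ∃ π, IsFeasiblePlan Ω₁ Ω₂ μ₁ μ₂ π ∧ v = primalValueEnt Ω₁ Ω₂ c γ π} =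
      sSup {v : EReal | ∃ α₁ α₂ : (Fin n → ℝ) → ℝ, ContinuousOn α₁ Ω₁ ∧ ContinuousOn α₂ Ω₂ ∧
        v = ((dualValueEnt Ω₁ Ω₂ μ₁ μ₂ c γ α₁ α₂ : ℝ) : EReal)} ∧
    (sSup {v : EReal | ∃ α₁ α₂ : (Fin n → ℝ) → ℝ, ContinuousOn α₁ Ω₁ ∧ ContinuousOn α₂ Ω₂ ∧
        v = ((dualValueEnt Ω₁ Ω₂ μ₁ μ₂ c γ α₁ α₂ : ℝ) : EReal)} ≠ ⊤ →
      ∃ π, IsFeasiblePlan Ω₁ Ω₂ μ₁ μ₂ π ∧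
        primalValueEnt Ω₁ Ω₂ c γ π =
          sInf {v : EReal | ∃ π', IsFeasiblePlan Ω₁ Ω₂ μ₁ μ₂ π' ∧
            v = primalValueEnt Ω₁ Ω₂ c γ π'}) := by
  set I := sInf {v : EReal | ∃ π, IsFeasiblePlan Ω₁ Ω₂ μ₁ μ₂ π ∧
    v = primalValueEnt Ω₁ Ω₂ c γ π}
  set D := {v : EReal | ∃ α₁ α₂ : (Fin n → ℝ) → ℝ, ContinuousOn α₁ Ω₁ ∧ ContinuousOn α₂ Ω₂ ∧
    v = ((dualValueEnt Ω₁ Ω₂ μ₁ μ₂ c γ α₁ α₂ : ℝ) : EReal)}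
  have hweak : sSup D ≤ I := by
    refine sSup_le ?_
    rintro _ ⟨α₁, α₂, h₁, h₂, rfl⟩
    refine le_sInf ?_
    rintro _ ⟨π, hπ, rfl⟩
    exact hπ.dualValueEnt_le_primalValueEnt hΩ₁ hΩ₂ hμ₁ hμ₂ hc hγ h₁ h₂
  have hI : ∀ π, IsFeasiblePlan Ω₁ Ω₂ μ₁ μ₂ π → I ≤ primalValueEnt Ω₁ Ω₂ c γ π :=
    fun π hπ => sInf_le ⟨π, hπ, rfl⟩
  have hattain : sSup D ≠ ⊤ → ∃ π, IsFeasiblePlan Ω₁ Ω₂ μ₁ μ₂ π ∧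
      primalValueEnt Ω₁ Ω₂ c γ π ≤ sSup D := by
    intro htop
    have hmem : ∀ α₁ α₂ : (Fin n → ℝ) → ℝ, ContinuousOn α₁ Ω₁ → ContinuousOn α₂ Ω₂ →
        ((dualValueEnt Ω₁ Ω₂ μ₁ μ₂ c γ α₁ α₂ : ℝ) : EReal) ≤ sSup D :=
      fun α₁ α₂ h₁ h₂ => le_sSup ⟨α₁, α₂, h₁, h₂, rfl⟩
    have hbot : sSup D ≠ ⊥ := fun h => by
      have := hmem 0 0 continuousOn_const continuousOn_const
      rw [h] at this
      exact EReal.coe_ne_bot _ (le_bot_iff.1 this)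
    lift sSup D to ℝ using ⟨htop, hbot⟩ with S
    exact exists_isFeasiblePlan_primalValueEnt_le hΩ₁ hΩ₂ hμ₁ hμ₂ hc hγ fun α₁ α₂ h₁ h₂ =>
      EReal.coe_le_coe_iff.1 (hmem α₁ α₂ h₁ h₂)
  refine ⟨le_antisymm ?_ hweak, fun htop => ?_⟩
  · by_cases htop : sSup D = ⊤
    · rw [htop]
      exact le_top
    · obtain ⟨π, hπ, hle⟩ := hattain htop
      exact (hI π hπ).trans hle
  · obtain ⟨π, hπ, hle⟩ := hattain htop
    exact ⟨π, hπ, (hle.trans hweak).antisymm (hI π hπ)⟩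
end

section
/- Discrete optimality system for quadratic regularization: in the discrete setting, a matrix π ∈ ℝ^{N×M} is an optimal solution of the quadratically regularized discrete optimal transport problem if and only if π is feasible (πᵢⱼ ≥ 0, row sums μ, column sums ν) and there exist vectors α ∈ ℝ^N and β ∈ ℝ^M such that πᵢⱼ = (αᵢ + βⱼ − cᵢⱼ)₊ / γ for all i, j. -/
open Finset

/-- Feasibility for the discrete transport problem: `π` is entrywise nonnegative with
row sums `μ` and column sums `ν`. -/
def IsFeasible {N M : ℕ} (μ : Fin N → ℝ) (ν : Fin M → ℝ)
    (π : Matrix (Fin N) (Fin M) ℝ) : Prop :=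
  (∀ i j, 0 ≤ π i j) ∧ (∀ i, ∑ j, π i j = μ i) ∧ (∀ j, ∑ i, π i j = ν j)

/-- The quadratically regularized discrete transport cost. -/
noncomputable def quadCost {N M : ℕ} (c : Matrix (Fin N) (Fin M) ℝ) (γ : ℝ)
    (π : Matrix (Fin N) (Fin M) ℝ) : ℝ :=
  (∑ i, ∑ j, c i j * π i j) + γ / 2 * ∑ i, ∑ j, π i j ^ 2

/-- **Farkas' lemma** for finitely many linear functionals on an arbitrary real vector space. -/
theorem farkas_of_linearMap {V ι : Type*} [AddCommGroup V] [Module ℝ V] (s : Finset ι)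
    (a : ι → V →ₗ[ℝ] ℝ) (b : V →ₗ[ℝ] ℝ)
    (h : ∀ x, (∀ k ∈ s, a k x ≤ 0) → b x ≤ 0) :
    ∃ l : ι → ℝ, (∀ k, 0 ≤ l k) ∧ ∀ x, b x = ∑ k ∈ s, l k * a k x := by
  classical
  induction s using Finset.induction_on generalizing a b with
  | empty =>
    refine ⟨0, fun _ => le_rfl, fun x => ?_⟩
    have h₁ := h x (by simp)
    have h₂ := h (-x) (by simp)
    rw [map_neg] at h₂
    simp only [sum_empty]
    linarith
  | insert n s hn ih =>
    by_cases hs : ∀ x, (∀ k ∈ s, a k x ≤ 0) → b x ≤ 0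
    · obtain ⟨l, hl, hb⟩ := ih a b hs
      refine ⟨Function.update l n 0, fun k => ?_, fun x => ?_⟩
      · by_cases hk : k = n
        · simp [hk]
        · simpa [hk] using hl k
      · rw [sum_insert hn, hb x, Function.update_self, zero_mul, zero_add]
        refine sum_congr rfl fun k hk => ?_
        rw [Function.update_of_ne (ne_of_mem_of_not_mem hk hn)]
    · push Not at hs
      obtain ⟨y, hy, hby⟩ := hs
      have hny : 0 < a n y := by
        by_contra! hle
        exact hby.not_ge (h y (by simpa using ⟨hle, hy⟩))
      obtain ⟨z, hz, hbz, hnz⟩ : ∃ z, (∀ k ∈ s, a k z ≤ 0) ∧ 0 < b z ∧ a n z = 1 := by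
        refine ⟨(a n y)⁻¹ • y, fun k hk => ?_, ?_, ?_⟩
        · rw [map_smul, smul_eq_mul]
          exact mul_nonpos_of_nonneg_of_nonpos (inv_nonneg.2 hny.le) (hy k hk)
        · rw [map_smul, smul_eq_mul]
          positivity
        · rw [map_smul, smul_eq_mul, inv_mul_cancel₀ hny.ne']
      obtain ⟨l, hl, hb⟩ := ih (fun k => a k - a k z • a n) (b - b z • a n) (by
        intro x hx
        have key := h (x - a n x • z) (by
          intro k hk
          rcases mem_insert.1 hk with rfl | hk
          · simp [hnz]
          · have := hx k hk
            simp only [LinearMap.sub_apply, LinearMap.smul_apply, map_sub, map_smul,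
              smul_eq_mul] at this ⊢
            linarith)
        simp only [LinearMap.sub_apply, LinearMap.smul_apply, map_sub, map_smul,
          smul_eq_mul] at key ⊢
        linarith)
      refine ⟨Function.update l n (b z - ∑ k ∈ s, l k * a k z), fun k => ?_, fun x => ?_⟩
      · by_cases hk : k = n
        · subst hk
          rw [Function.update_self]
          have : ∑ k ∈ s, l k * a k z ≤ 0 :=
            sum_nonpos fun k hk => mul_nonpos_of_nonneg_of_nonpos (hl k) (hz k hk)
          linarith
        · simpa [hk] using hl k
      · have hsum : ∑ k ∈ s, Function.update l n (b z - ∑ k ∈ s, l k * a k z) k * a k x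
            = ∑ k ∈ s, l k * a k x :=
          sum_congr rfl fun k hk => by
            rw [Function.update_of_ne (ne_of_mem_of_not_mem hk hn)]
        have hbx := hb x
        simp only [LinearMap.sub_apply, LinearMap.smul_apply, smul_eq_mul, mul_sub,
          sum_sub_distrib, ← mul_assoc, ← sum_mul] at hbx
        rw [sum_insert hn, hsum, Function.update_self]
        linarith

/-- Second-order expansion of the cost; it is exact since the cost is quadratic. -/
theorem quadCost_add {N M : ℕ} (c : Matrix (Fin N) (Fin M) ℝ) (γ : ℝ)
    (π d : Matrix (Fin N) (Fin M) ℝ) :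
    quadCost c γ (π + d) = quadCost c γ π + ∑ i, ∑ j, (c i j + γ * π i j) * d i j
      + γ / 2 * ∑ i, ∑ j, d i j ^ 2 := by
  simp only [quadCost, mul_sum, ← sum_add_distrib, Matrix.add_apply]
  refine sum_congr rfl fun i _ => sum_congr rfl fun j _ => ?_
  ring

/-- At a minimizer the directional derivative of the cost is nonnegative along every
feasible direction. -/
theorem gradient_nonneg_of_isMin {N M : ℕ} {μ : Fin N → ℝ} {ν : Fin M → ℝ}
    {c : Matrix (Fin N) (Fin M) ℝ} {γ : ℝ} {π : Matrix (Fin N) (Fin M) ℝ}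
    (hπ : IsFeasible μ ν π)
    (hmin : ∀ π', IsFeasible μ ν π' → quadCost c γ π ≤ quadCost c γ π')
    {d : Matrix (Fin N) (Fin M) ℝ} (hrow : ∀ i, ∑ j, d i j = 0) (hcol : ∀ j, ∑ i, d i j = 0)
    (hd : ∀ i j, π i j = 0 → 0 ≤ d i j) :
    0 ≤ ∑ i, ∑ j, (c i j + γ * π i j) * d i j := by
  obtain ⟨hnn, hμ, hν⟩ := hπ
  set G := ∑ i, ∑ j, (c i j + γ * π i j) * d i j with hG
  set K := γ / 2 * ∑ i, ∑ j, d i j ^ 2 with hK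
  have hlim : Filter.Tendsto (fun t : ℝ => G + t * K) (nhdsWithin 0 (Set.Ioi 0)) (nhds G) := by
    have : Filter.Tendsto (fun t : ℝ => G + t * K) (nhds 0) (nhds (G + 0 * K)) :=
      Continuous.tendsto (by fun_prop) 0
    rw [zero_mul, add_zero] at this
    exact this.mono_left nhdsWithin_le_nhds
  have hpos : ∀ᶠ t : ℝ in nhdsWithin 0 (Set.Ioi 0), ∀ i j, 0 ≤ π i j + t * d i j := by
    refine Filter.eventually_all.2 fun i => Filter.eventually_all.2 fun j => ?_
    rcases (hnn i j).eq_or_lt with h0 | h0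
    · filter_upwards [self_mem_nhdsWithin] with t (ht : 0 < t)
      rw [← h0, zero_add]
      exact mul_nonneg ht.le (hd i j h0.symm)
    · have : Filter.Tendsto (fun t : ℝ => π i j + t * d i j) (nhds 0)
          (nhds (π i j + 0 * d i j)) := Continuous.tendsto (by fun_prop) 0
      rw [zero_mul, add_zero] at this
      filter_upwards [nhdsWithin_le_nhds (this.eventually (lt_mem_nhds h0))] with t ht
      exact ht.le
  refine ge_of_tendsto hlim ?_
  filter_upwards [hpos, self_mem_nhdsWithin] with t ht (ht0 : 0 < t)
  have hle := hmin (π + t • d) ⟨ht, fun i => by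
    simp [sum_add_distrib, ← mul_sum, hrow, hμ], fun j => by
    simp [sum_add_distrib, ← mul_sum, hcol, hν]⟩
  have hexp : quadCost c γ (π + t • d) = quadCost c γ π + t * (G + t * K) := by
    rw [quadCost_add, hG, hK]
    simp only [Matrix.smul_apply, smul_eq_mul, mul_sum, mul_add, ← sum_add_distrib, add_assoc]
    congr 1
    refine sum_congr rfl fun i _ => sum_congr rfl fun j _ => ?_
    ring
  exact nonneg_of_mul_nonneg_right (by linarith) ht0

/-- Dual potentials: a cost that is nonnegative along all directions with vanishing marginals
that are nonnegative on `P` dominates some `α ⊕ β`, with equality off `P`. -/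
theorem exists_potentials {I J : Type*} [Fintype I] [Fintype J] (g : Matrix I J ℝ)
    (P : I → J → Prop)
    (h : ∀ d : Matrix I J ℝ, (∀ i, ∑ j, d i j = 0) → (∀ j, ∑ i, d i j = 0) →
      (∀ i j, P i j → 0 ≤ d i j) → 0 ≤ ∑ i, ∑ j, g i j * d i j) :
    ∃ (α : I → ℝ) (β : J → ℝ), (∀ i j, α i + β j ≤ g i j) ∧
      ∀ i j, ¬ P i j → α i + β j = g i j := by
  classical
  let e (i : I) (j : J) : Matrix I J ℝ →ₗ[ℝ] ℝ := Matrix.entryLinearMap ℝ ℝ i j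
  let row (i : I) : Matrix I J ℝ →ₗ[ℝ] ℝ := ∑ j, e i j
  let col (j : J) : Matrix I J ℝ →ₗ[ℝ] ℝ := ∑ i, e i j
  let a : (I ⊕ I) ⊕ (J ⊕ J) ⊕ I × J → Matrix I J ℝ →ₗ[ℝ] ℝ :=
    Sum.elim (Sum.elim row (-row))
      (Sum.elim (Sum.elim col (-col)) fun p => (if P p.1 p.2 then -1 else 0 : ℝ) • e p.1 p.2)
  obtain ⟨l, hl, hb⟩ := farkas_of_linearMap univ a (-∑ i, ∑ j, g i j • e i j) (by
    intro d hd
    simp only [mem_univ, true_imp_iff, Sum.forall, Prod.forall, a, Sum.elim_inl, Sum.elim_inr,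
      Pi.neg_apply, LinearMap.neg_apply, LinearMap.smul_apply, row, col, e, LinearMap.sum_apply,
      Matrix.entryLinearMap_apply] at hd
    obtain ⟨⟨r₁, r₂⟩, ⟨c₁, c₂⟩, hp⟩ := hd
    have := h d (fun i => le_antisymm (r₁ i) (by linarith [r₂ i]))
      (fun j => le_antisymm (c₁ j) (by linarith [c₂ j])) (fun i j hij => by
        simpa [hij] using hp i j)
    simpa [e, LinearMap.sum_apply] using this)
  have hg : ∀ i j, g i j = (l (.inl (.inr i)) - l (.inl (.inl i)))
      + (l (.inr (.inl (.inr j))) - l (.inr (.inl (.inl j))))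
      + if P i j then l (.inr (.inr (i, j))) else 0 := by
    intro i j
    have hij := hb (Matrix.single i j 1)
    simp [a, e, row, col, LinearMap.sum_apply, Matrix.single_apply, ite_and,
      Fintype.sum_prod_type, -ite_smul] at hij
    split_ifs at hij ⊢ <;> linarith
  refine ⟨fun i => l (.inl (.inr i)) - l (.inl (.inl i)),
    fun j => l (.inr (.inl (.inr j))) - l (.inr (.inl (.inl j))), fun i j => ?_, fun i j hij => ?_⟩
  · have := hl (.inr (.inr (i, j)))
    rw [hg i j]
    split_ifs <;> linarith
  · rw [hg i j, if_neg hij, add_zero]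

/-- Discrete optimality system for quadratic regularization: `π` is optimal iff it is
feasible and of the form `πᵢⱼ = (αᵢ + βⱼ − cᵢⱼ)₊ / γ` for some dual vectors `α, β`. -/
theorem quad_discrete_optimality {N M : ℕ} (μ : Fin N → ℝ) (ν : Fin M → ℝ)
    (hμ : ∀ i, 0 ≤ μ i) (hν : ∀ j, 0 ≤ ν j) (hmass : ∑ i, μ i = ∑ j, ν j)
    (c : Matrix (Fin N) (Fin M) ℝ) (γ : ℝ) (hγ : 0 < γ)
    (π : Matrix (Fin N) (Fin M) ℝ) :
    (IsFeasible μ ν π ∧ ∀ π', IsFeasible μ ν π' → quadCost c γ π ≤ quadCost c γ π') ↔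
    (IsFeasible μ ν π ∧ ∃ (α : Fin N → ℝ) (β : Fin M → ℝ),
      ∀ i j, π i j = max (α i + β j - c i j) 0 / γ) := by
  constructor
  · rintro ⟨hπ, hmin⟩
    obtain ⟨α, β, hle, heq⟩ := exists_potentials (fun i j => c i j + γ * π i j)
      (fun i j => π i j = 0) fun d => gradient_nonneg_of_isMin hπ hmin
    refine ⟨hπ, α, β, fun i j => ?_⟩
    rw [eq_div_iff hγ.ne']
    by_cases h0 : π i j = 0
    · have := hle i j
      rw [h0] at this ⊢
      rw [max_eq_right (by linarith), zero_mul]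
    · have h1 := heq i j h0
      have h2 := mul_nonneg hγ.le (hπ.1 i j)
      rw [max_eq_left (by linarith)]
      linarith
  · rintro ⟨hπ, α, β, hform⟩
    refine ⟨hπ, fun π' hπ' => ?_⟩
    have hexp := quadCost_add c γ π (π' - π)
    rw [add_sub_cancel] at hexp
    have hdual : ∑ i, ∑ j, (α i + β j) * (π' - π) i j = 0 := by
      have hα : ∑ i, ∑ j, α i * (π' - π) i j = 0 := by
        simp [← mul_sum, sum_sub_distrib, hπ.2.1, hπ'.2.1]
      have hβ : ∑ i, ∑ j, β j * (π' - π) i j = 0 := by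
        rw [sum_comm]
        simp [← mul_sum, sum_sub_distrib, hπ.2.2, hπ'.2.2]
      simp only [add_mul, sum_add_distrib, hα, hβ, add_zero]
    have hgrad : ∑ i, ∑ j, (α i + β j) * (π' - π) i j
        ≤ ∑ i, ∑ j, (c i j + γ * π i j) * (π' - π) i j := by
      refine sum_le_sum fun i _ => sum_le_sum fun j _ => ?_
      have hγπ : γ * π i j = max (α i + β j - c i j) 0 := by
        rw [hform i j, mul_div_cancel₀ _ hγ.ne']
      rcases le_total (α i + β j - c i j) 0 with hneg | hnonneg
      · have h0 : π i j = 0 := by rw [hform i j, max_eq_right hneg, zero_div]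
        rw [Matrix.sub_apply, h0, mul_zero, add_zero, sub_zero]
        exact mul_le_mul_of_nonneg_right (by linarith) (hπ'.1 i j)
      · rw [hγπ, max_eq_left hnonneg, add_sub_cancel]
    have hsq : 0 ≤ γ / 2 * ∑ i, ∑ j, (π' - π) i j ^ 2 := by positivity
    linarith
end

section
/- Discrete entropic optimality (sufficiency): let μ ∈ ℝ^N, ν ∈ ℝ^M be entrywise nonnegative with ∑ᵢ μᵢ = ∑ⱼ νⱼ, let c ∈ ℝ^{N×M} and γ > 0. If there exist α ∈ ℝ^N and β ∈ ℝ^M such that the matrix πᵢⱼ := exp((αᵢ + βⱼ − cᵢⱼ)/γ) satisfies ∑ⱼ πᵢⱼ = μᵢ for all i and ∑ᵢ πᵢⱼ = νⱼ for all j, then π minimizes ∑ᵢⱼ cᵢⱼ π'ᵢⱼ + γ·∑ᵢⱼ π'ᵢⱼ log π'ᵢⱼ (with 0·log 0 := 0) over all entrywise nonnegative π' ∈ ℝ^{N×M} with row sums μ and column sums ν. -/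
open Finset

/-- The entropically regularized discrete transport cost (with `0 log 0 := 0`,
which is how `Real.log` behaves at `0`). -/
noncomputable def entCost {N M : ℕ} (c : Matrix (Fin N) (Fin M) ℝ) (γ : ℝ)
    (π : Matrix (Fin N) (Fin M) ℝ) : ℝ :=
  (∑ i, ∑ j, c i j * π i j) + γ * ∑ i, ∑ j, π i j * Real.log (π i j)

/-- The Fenchel–Young inequality for the entropy `x ↦ x log x - x` and its conjugate `exp`. -/
theorem mul_add_one_sub_exp_le_mul_log {x : ℝ} (hx : 0 ≤ x) (s : ℝ) :
    x * (s + 1) - Real.exp s ≤ x * Real.log x := by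
  rcases hx.eq_or_lt with rfl | hx
  · simpa using Real.exp_nonneg s
  · have h := mul_le_mul_of_nonneg_left (Real.add_one_le_exp (s - Real.log x)) hx.le
    rw [Real.exp_sub, Real.exp_log hx, mul_div_cancel₀ _ hx.ne'] at h
    linarith

/-- Integrating a separable potential `α ⊕ β` against a plan only sees its marginals. -/
theorem sum_sum_add_mul {N M : ℕ} {μ : Fin N → ℝ} {ν : Fin M → ℝ}
    {π : Matrix (Fin N) (Fin M) ℝ} (hrow : ∀ i, ∑ j, π i j = μ i)
    (hcol : ∀ j, ∑ i, π i j = ν j) (α : Fin N → ℝ) (β : Fin M → ℝ) :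
    ∑ i, ∑ j, (α i + β j) * π i j = ∑ i, α i * μ i + ∑ j, β j * ν j := by
  simp only [add_mul, sum_add_distrib, ← hrow, ← hcol, mul_sum]
  rw [sum_comm (f := fun i j => β j * π i j)]

/-- The entropic cost as a single double sum. -/
theorem entCost_eq_sum {N M : ℕ} (c : Matrix (Fin N) (Fin M) ℝ) (γ : ℝ)
    (π : Matrix (Fin N) (Fin M) ℝ) :
    entCost c γ π = ∑ i, ∑ j, (c i j * π i j + γ * (π i j * Real.log (π i j))) := by
  simp only [entCost, sum_add_distrib, mul_sum]

/-- Discrete entropic optimality (sufficiency): if `πᵢⱼ = exp((αᵢ + βⱼ − cᵢⱼ)/γ)` has row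
sums `μ` and column sums `ν`, then `π` minimizes the entropically regularized discrete
transport cost over all feasible plans. -/
theorem entropic_discrete_sufficiency {N M : ℕ} (μ : Fin N → ℝ) (ν : Fin M → ℝ)
    (hμ : ∀ i, 0 ≤ μ i) (hν : ∀ j, 0 ≤ ν j) (hmass : ∑ i, μ i = ∑ j, ν j)
    (c : Matrix (Fin N) (Fin M) ℝ) (γ : ℝ) (hγ : 0 < γ)
    (α : Fin N → ℝ) (β : Fin M → ℝ)
    (π : Matrix (Fin N) (Fin M) ℝ)
    (hπ : ∀ i j, π i j = Real.exp ((α i + β j - c i j) / γ))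
    (hrow : ∀ i, ∑ j, π i j = μ i) (hcol : ∀ j, ∑ i, π i j = ν j) :
    ∀ π', IsFeasible μ ν π' → entCost c γ π ≤ entCost c γ π' := by
  rintro π' ⟨hnonneg, hrow', hcol'⟩
  have hcost : entCost c γ π = ∑ i, ∑ j, (α i + β j) * π i j := by
    rw [entCost_eq_sum]
    refine sum_congr rfl fun i _ => sum_congr rfl fun j _ => ?_
    have hlog : γ * Real.log (π i j) = α i + β j - c i j := by
      rw [hπ, Real.log_exp, mul_div_cancel₀ _ hγ.ne']
    linear_combination π i j * hlog
  have htotal : ∑ i, ∑ j, π i j = ∑ i, ∑ j, π' i j := by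
    simp only [hrow, hrow']
  calc entCost c γ π = ∑ i, ∑ j, ((α i + β j) * π' i j + γ * (π' i j - π i j)) := by
        simp only [hcost, sum_add_distrib, ← mul_sum, sum_sub_distrib, htotal,
          sum_sum_add_mul hrow hcol, sum_sum_add_mul hrow' hcol', sub_self, mul_zero, add_zero]
    _ ≤ entCost c γ π' := by
        rw [entCost_eq_sum]
        refine sum_le_sum fun i _ => sum_le_sum fun j _ => ?_
        have h := mul_le_mul_of_nonneg_left
          (mul_add_one_sub_exp_le_mul_log (hnonneg i j) ((α i + β j - c i j) / γ)) hγ.le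
        rw [← hπ] at h
        have hs : γ * ((α i + β j - c i j) / γ) = α i + β j - c i j :=
          mul_div_cancel₀ _ hγ.ne'
        linear_combination h - π' i j * hs
end
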